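/- Let η ∈ (0,1/4), a ∈ (ℤ\{0})⁴, B ≥ 1, let w be one of the weights w₁ or w₂, and let c ∈ ℤ⁴ and k ∈ {0,1}. Then the function q ↦ I_{q,a}(c) is differentiable on (0,∞) and: (1) if k = 0 or c = 0, then |q^k·(d^k/dq^k)I_{q,a}(c)| ≪ P₁P₂P₃P₄; (2) if k = 1 and c ≠ 0, then |q·(d/dq)I_{q,a}(c)| ≪ η⁻¹·P₁P₂P₃P₄; with absolute implied constants. -/

import Mathlib

open scoped BigOperators
open MeasureTheory Filter

attribute [local instance 0] Classical.propDecidable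

noncomputable section

/-- `e(t) = exp(2πit)`. -/
def eC (t : ℝ) : ℂ := Complex.exp (2 * Real.pi * Complex.I * t)

/-- A nonzero integer `z` is squareful if `p² ∣ z` for every prime `p` dividing `z`. -/
def Squareful (z : ℤ) : Prop := ∀ p : ℕ, p.Prime → (p : ℤ) ∣ z → (p : ℤ) ^ 2 ∣ z

/-- The standard bump function in one variable. -/
def psi1 (t : ℝ) : ℝ := if |t| < 1 then Real.exp (-(1 - t ^ 2)⁻¹) else 0

/-- The smooth weight `w₁`. -/
def w1 (η : ℝ) (x : Fin 4 → ℝ) : ℝ :=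
  if ‖x‖ ≤ η then 0
  else if ‖x‖ ≤ 2 * η then Real.exp 1 * psi1 (‖x‖ / η - 2)
  else if ‖x‖ ≤ 1 - η then 1
  else if ‖x‖ ≤ 1 then Real.exp 1 * psi1 (‖x‖ / η - (1 - η) / η)
  else 0

/-- The smooth weight `w₂`. -/
def w2 (η : ℝ) (x : Fin 4 → ℝ) : ℝ :=
  if ‖x‖ ≤ η then 0
  else if ‖x‖ ≤ 2 * η then Real.exp 1 * psi1 (‖x‖ / η - 2)
  else if ‖x‖ ≤ 1 then 1
  else if ‖x‖ ≤ 1 + η then Real.exp 1 * psi1 (‖x‖ / η - 1 / η)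
  else 0

/-- `u(t) = c₀ ψ₁(4t - 3)`, normalised so that `∫ u = 1`. -/
def uFn (t : ℝ) : ℝ := (∫ s : ℝ, psi1 (4 * s - 3))⁻¹ * psi1 (4 * t - 3)

/-- Heath-Brown's function `h(x, y)`. -/
def hFn (x y : ℝ) : ℝ :=
  ∑' j : ℕ, (x * ((j : ℝ) + 1))⁻¹ *
    (uFn (x * ((j : ℝ) + 1)) - uFn (|y| / (x * ((j : ℝ) + 1))))

/-- The exponential sum `S_{q,a}(c)`. -/
def Sqa (a c : Fin 4 → ℤ) (q : ℕ) : ℂ :=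
  ∑ k ∈ (Finset.range q).filter fun k => Nat.gcd k q = 1,
    ∑ b ∈ Fintype.piFinset fun _ : Fin 4 => Finset.range q,
      eC (((((k : ℤ) * (∑ i, a i * (b i : ℤ) ^ 2) + ∑ i, (b i : ℤ) * c i) : ℤ) : ℝ) / (q : ℝ))

/-- Partial sums of the singular series `𝔊_a`. -/
def singularPartial (a : Fin 4 → ℤ) (T : ℕ) : ℂ :=
  ∑ q ∈ Finset.Icc 1 T, (1 / (q : ℂ) ^ 4) * Sqa a 0 q

/-- The quadratic form `G(x) = Σ εᵢ xᵢ²`. -/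
def Gquad (e : Fin 4 → ℤ) (x : Fin 4 → ℝ) : ℝ := ∑ i, (e i : ℝ) * x i ^ 2

/-- The singular integral `σ_∞(ε)`. -/
def sigmaInf (e : Fin 4 → ℤ) : ℂ :=
  ∫ θ : ℝ, ∫ x in Set.univ.pi fun _ : Fin 4 => Set.Icc (-1 : ℝ) 1, eC (-(θ * Gquad e x))

/-- The weighted singular integral `σ_∞(w)`. -/
def sigmaInfW (w : (Fin 4 → ℝ) → ℝ) (e : Fin 4 → ℤ) : ℂ :=
  ∫ θ : ℝ, ∫ x : Fin 4 → ℝ, (w x : ℂ) * eC (-(θ * Gquad e x))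

/-- `Pᵢ = (B / |aᵢ|)^{1/2}`. -/
def Pvec (a : Fin 4 → ℤ) (B : ℝ) (i : Fin 4) : ℝ := Real.sqrt (B / ((a i).natAbs : ℝ))

/-- The oscillatory integral `I_{q,a}(c)`. -/
def Iqa (w : (Fin 4 → ℝ) → ℝ) (a : Fin 4 → ℤ) (B : ℝ) (c : Fin 4 → ℤ) (q : ℝ) : ℂ :=
  ∫ x : Fin 4 → ℝ,
    (w (fun i => x i / Pvec a B i) : ℂ) *
      (hFn (q / Real.sqrt B) ((∑ i, (a i : ℝ) * x i ^ 2) / B) : ℂ) *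
      eC (-(∑ i, (c i : ℝ) * x i) / q)

/-- `Δ(v) = ∏ᵢ gcd(vᵢ, ∏_{j≠i} vⱼ)`. -/
def Delta4 (v : Fin 4 → ℤ) : ℕ :=
  ∏ i, Int.gcd (v i) (∏ j ∈ Finset.univ.erase i, v j)

/-- `Δ_c(a) = ∏ᵢ gcd(gcd(aᵢ,cᵢ), ∏_{j≠i} gcd(aⱼ,cⱼ))`. -/
def DeltaC (a c : Fin 4 → ℤ) : ℕ :=
  ∏ i, Int.gcd (Int.gcd (a i) (c i) : ℤ) (∏ j ∈ Finset.univ.erase i, (Int.gcd (a j) (c j) : ℤ))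

/-- The dual form `F*_a(c)`. -/
def dualForm (a c : Fin 4 → ℤ) : ℤ :=
  ∑ i, (∏ j ∈ Finset.univ.erase i, a j) * c i ^ 2

/-- The counting function `N_a(B)`. -/
def Na (a : Fin 4 → ℤ) (B : ℝ) : ℕ :=
  {x : Fin 4 → ℤ | (∀ i, x i ≠ 0) ∧ (∑ i, a i * x i ^ 2) = 0 ∧
    ∀ i, (((a i * x i ^ 2).natAbs : ℝ)) ≤ B}.ncard

/-- The smoothly weighted counting function `N_{w,a}(B)`. -/
def Nwa (w : (Fin 4 → ℝ) → ℝ) (a : Fin 4 → ℤ) (B : ℝ) : ℝ :=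
  ∑' x : Fin 4 → ℤ,
    if (∀ i, x i ≠ 0) ∧ (∑ i, a i * x i ^ 2) = 0 then
      w fun i => (x i : ℝ) / Pvec a B i
    else 0

/-- The inclusion-exclusion weights `ω(r, s, s₀)`. -/
def omegaFn (r s : Fin 4 → ℕ) (s0 : ℕ) : ℤ :=
  if (∀ i, Squarefree (r i)) ∧ (∀ i, Squarefree (s i)) ∧
      Finset.univ.gcd s = 1 ∧ (∀ i, Nat.gcd s0 (s i) = 1) ∧
      ∀ p : ℕ, p.Prime → p ∣ (∏ i, r i) * ∏ i, s i → ∀ i, p ∣ r i * s i then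
    ArithmeticFunction.moebius s0 *
      ∏ p ∈ ((∏ i, r i) * ∏ i, s i).primeFactors,
        (-1 : ℤ) ^ (((∏ i, r i) * ∏ i, s i).factorization p + 1)
  else 0

/-- The cardinality of the set `𝒩(B; r, s, s₀)`. -/
def calN (B D : ℝ) (r s : Fin 4 → ℕ) (s0 : ℕ) : ℕ :=
  {z : Fin 4 → ℤ | (∀ i, z i ≠ 0) ∧ (∀ i, Squareful (z i)) ∧
    (∀ i, (((z i).natAbs : ℝ)) ≤ B) ∧ (∑ i, z i) = 0 ∧
    ∃ x y : Fin 4 → ℤ,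
      (∀ i, 0 < x i ∧ Squarefree (y i) ∧ z i = x i ^ 2 * y i ^ 3 ∧
        (r i : ℤ) ∣ y i ∧ (s i : ℤ) ∣ x i ∧ (s0 : ℤ) ∣ x i) ∧
      (((∏ i, y i).natAbs : ℝ)) ≤ D ∧ ¬ IsSquare (∏ i, y i)}.ncard

/-- The local counting function `M_n(y, p)`. -/
def Mcount (y : Fin 4 → ℤ) (p n : ℕ) : ℕ :=
  {m : Fin 4 → ℕ | (∀ i, m i < p ^ n) ∧ ((p : ℤ) ^ n ∣ ∑ i, y i ^ 3 * (m i : ℤ) ^ 2) ∧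
    ∃ j, ¬ (p : ℤ) ∣ (m j : ℤ) * y j}.ncard

end


/-! ### Smooth functions supported in `[1/2, 2]` and their dilated sums -/

/-- Smooth functions vanishing outside `[1/2, 2]`. -/
structure GoodFn (f : ℝ → ℝ) : Prop where
  smooth : ContDiff ℝ (⊤ : ℕ∞) f
  supp : ∀ t, t ∉ Set.Icc (1/2 : ℝ) 2 → f t = 0

/-- The operator multiplying the derivative by the variable. -/
noncomputable def tD (f : ℝ → ℝ) (t : ℝ) : ℝ := t * deriv f t

/-- `S_f(x) = Σ_{j ≥ 1} f(xj)`. -/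
noncomputable def Ssum (f : ℝ → ℝ) (x : ℝ) : ℝ := ∑' j : ℕ, f (x * ((j : ℝ) + 1))

namespace GoodFn

variable {f g : ℝ → ℝ}

theorem tD (hf : GoodFn f) : GoodFn (tD f) where
  smooth := by
    unfold _root_.tD
    have h : ContDiff ℝ (⊤ : ℕ∞) (deriv f) := by
      have := hf.smooth
      rw [contDiff_infty_iff_deriv] at this
      exact this.2
    exact contDiff_id.mul h
  supp := by
    intro t ht
    have : f =ᶠ[nhds t] fun _ => 0 := by
      filter_upwards [isClosed_Icc.isOpen_compl.mem_nhds ht] with s hs using hf.supp s hs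
    simp [_root_.tD, this.deriv_eq]

theorem linComb (hf : GoodFn f) (hg : GoodFn g) (a b : ℝ) :
    GoodFn (fun t => a * f t + b * g t) where
  smooth := (contDiff_const.mul hf.smooth).add (contDiff_const.mul hg.smooth)
  supp := by
    intro t ht
    simp [hf.supp t ht, hg.supp t ht]

theorem hasCompactSupport (hf : GoodFn f) : HasCompactSupport f :=
  HasCompactSupport.intro isCompact_Icc hf.supp

theorem integrable (hf : GoodFn f) : Integrable f :=
  hf.smooth.continuous.integrable_of_hasCompactSupport hf.hasCompactSupport

theorem bounded (hf : GoodFn f) : ∃ M : ℝ, 0 ≤ M ∧ ∀ t, |f t| ≤ M := by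
  obtain ⟨M, hM⟩ := hf.smooth.continuous.bounded_above_of_compact_support hf.hasCompactSupport
  exact ⟨M, (norm_nonneg _).trans (hM 0), hM⟩

theorem hasDerivAt (hf : GoodFn f) (t : ℝ) : HasDerivAt f (deriv f t) t :=
  (hf.smooth.differentiable (by simp) t).hasDerivAt

theorem integral_tD (hf : GoodFn f) : ∫ t, _root_.tD f t = - ∫ t, f t := by
  have h : ∫ t, (f t + _root_.tD f t) = 0 := by
    apply integral_eq_zero_of_hasDerivAt_of_integrable (f := fun t => t * f t)
    · intro t
      have := (hasDerivAt_id' t).fun_mul (hf.hasDerivAt t)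
      rw [one_mul] at this
      exact this
    · exact hf.integrable.add hf.tD.integrable
    · exact (continuous_id.mul hf.smooth.continuous).integrable_of_hasCompactSupport
        hf.hasCompactSupport.mul_left
  rw [integral_add hf.integrable hf.tD.integrable] at h
  linarith

theorem eq_zero_of_ge (hf : GoodFn f) {x : ℝ} (hx : 0 < x) {N : ℕ} (hN : 2 < x * (N + 1)) {j : ℕ}
    (hj : N ≤ j) : f (x * ((j : ℝ) + 1)) = 0 := by
  apply hf.supp
  intro h
  have : (N : ℝ) ≤ j := by exact_mod_cast hj
  have := h.2
  nlinarith

theorem Ssum_eq (hf : GoodFn f) {x : ℝ} (hx : 0 < x) {N : ℕ} (hN : 2 < x * (N + 1)) :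
    Ssum f x = ∑ j ∈ Finset.range N, f (x * ((j : ℝ) + 1)) := by
  apply tsum_eq_sum
  intro j hj
  exact hf.eq_zero_of_ge hx hN (by simpa using hj)

theorem summable (hf : GoodFn f) {x : ℝ} (hx : 0 < x) :
    Summable (fun j : ℕ => f (x * ((j : ℝ) + 1))) := by
  obtain ⟨N, hN⟩ := exists_nat_gt (2 / x)
  rw [div_lt_iff₀ hx] at hN
  refine summable_of_ne_finset_zero (s := Finset.range N) ?_
  intro j hj
  exact hf.eq_zero_of_ge (N := N) hx (by nlinarith) (by simpa using hj)

theorem summable' (hf : GoodFn f) (x : ℝ) :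
    Summable (fun j : ℕ => f (x * ((j : ℝ) + 1))) := by
  rcases lt_or_ge 0 x with hx | hx
  · exact hf.summable hx
  · convert summable_zero with j
    apply hf.supp
    intro h
    have := h.1
    have : (0 : ℝ) ≤ j := by positivity
    nlinarith

theorem measurable_Ssum (hf : GoodFn f) : Measurable (Ssum f) := by
  refine measurable_of_tendsto_metrizable
    (f := fun (n : ℕ) x => ∑ j ∈ Finset.range n, f (x * ((j : ℝ) + 1))) (fun n => ?_) ?_
  · have := hf.smooth.continuous
    exact (by fun_prop : Continuous fun x => ∑ j ∈ Finset.range n, f (x * ((j : ℝ) + 1))).measurable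
  · rw [tendsto_pi_nhds]
    intro x
    exact (hf.summable' x).hasSum.tendsto_sum_nat

theorem hasDerivAt_Ssum (hf : GoodFn f) {x : ℝ} (hx : 0 < x) :
    HasDerivAt (Ssum f) (x⁻¹ * Ssum (_root_.tD f) x) x := by
  obtain ⟨N, hN⟩ := exists_nat_gt (4 / x)
  rw [div_lt_iff₀ hx] at hN
  have h1 : Ssum f =ᶠ[nhds x] fun y => ∑ j ∈ Finset.range N, f (y * ((j : ℝ) + 1)) := by
    filter_upwards [lt_mem_nhds (show x / 2 < x by linarith)] with y hy
    exact hf.Ssum_eq (by linarith) (by nlinarith [(Nat.cast_nonneg N : (0:ℝ) ≤ N)])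
  refine HasDerivAt.congr_of_eventuallyEq ?_ h1
  rw [hf.tD.Ssum_eq (N := N) hx (by nlinarith), Finset.mul_sum]
  refine HasDerivAt.fun_sum fun j _ => ?_
  have h2 := (hf.hasDerivAt (x * ((j : ℝ) + 1))).comp x ((hasDerivAt_id x).mul_const ((j : ℝ) + 1))
  refine HasDerivAt.congr_deriv (f := fun y => f (y * ((j : ℝ) + 1))) h2 ?_
  show _ = x⁻¹ * (x * ((j : ℝ) + 1) * deriv f (x * ((j : ℝ) + 1)))
  field_simp

theorem Ssum_bound (hf : GoodFn f) : ∃ M : ℝ, 0 ≤ M ∧ ∀ x, 0 < x → |Ssum f x| ≤ M / x := by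
  obtain ⟨M, hM0, hM⟩ := hf.bounded
  refine ⟨2 * M, by positivity, fun x hx => ?_⟩
  have hN : 2 < x * ((⌊2 / x⌋₊ : ℕ) + 1 : ℝ) := by
    have := Nat.lt_floor_add_one (2 / x)
    rw [div_lt_iff₀ hx] at this
    linarith
  have hN' : (⌊2 / x⌋₊ : ℝ) ≤ 2 / x := Nat.floor_le (by positivity)
  rw [hf.Ssum_eq hx hN]
  calc |∑ j ∈ Finset.range ⌊2 / x⌋₊, f (x * ((j : ℝ) + 1))|
      ≤ ∑ j ∈ Finset.range ⌊2 / x⌋₊, |f (x * ((j : ℝ) + 1))| := Finset.abs_sum_le_sum_abs _ _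
    _ ≤ ∑ j ∈ Finset.range ⌊2 / x⌋₊, M := Finset.sum_le_sum fun j _ => hM _
    _ = ⌊2 / x⌋₊ * M := by simp
    _ ≤ 2 / x * M := by gcongr
    _ = 2 * M / x := by ring

theorem trap_bound (hf : GoodFn f) : ∃ M : ℝ, 0 ≤ M ∧ ∀ x, 0 < x → x ≤ 1 →
    |x * Ssum f x - ∫ t, f t| ≤ M * x ^ 2 := by
  have hsm : ContDiff ℝ 2 f := hf.smooth.of_le (by norm_cast)
  have hcd : Continuous (deriv (deriv f)) := by
    have h1 := hf.smooth
    rw [contDiff_infty_iff_deriv] at h1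
    have h2 := h1.2
    rw [contDiff_infty_iff_deriv] at h2
    exact h2.2.continuous
  have hcs : HasCompactSupport (deriv (deriv f)) := hf.hasCompactSupport.deriv.deriv
  obtain ⟨Z, hZ⟩ := hcd.bounded_above_of_compact_support hcs
  have hZ0 : 0 ≤ Z := (norm_nonneg _).trans (hZ 0)
  refine ⟨64 * Z, by positivity, fun x hx hx1 => ?_⟩
  obtain ⟨N, hN0, hN1, hN2⟩ : ∃ N : ℕ, 0 < N ∧ 2 < x * N ∧ x * N ≤ 4 := by
    refine ⟨⌊2 / x⌋₊ + 1, by omega, ?_, ?_⟩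
    · have := Nat.lt_floor_add_one (2 / x)
      rw [div_lt_iff₀ hx] at this
      push_cast; linarith
    · have := Nat.floor_le (show 0 ≤ 2 / x by positivity)
      rw [le_div_iff₀ hx] at this
      push_cast; linarith
  have hxN : 0 < x * N := by linarith
  have hu : Set.uIcc 0 (x * N) = Set.Icc 0 (x * N) := Set.uIcc_of_le hxN.le
  have key := trapezoidal_error_le_of_c2 (f := f) (a := 0) (b := x * N) (ζ := Z) hsm.contDiffOn
    (fun t => by
      by_cases ht : t ∈ Set.uIcc 0 (x * N)
      · have hud : UniqueDiffOn ℝ (Set.uIcc 0 (x * N)) := by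
          rw [hu]; exact uniqueDiffOn_Icc hxN
        rw [iteratedDerivWithin_eq_iteratedDeriv hud hsm.contDiffAt ht, iteratedDeriv_succ,
          iteratedDeriv_one]
        exact hZ t
      · have hcl : t ∉ closure (Set.uIcc 0 (x * N)) := by
          rwa [hu, isClosed_Icc.closure_eq, ← hu]
        rw [iteratedDerivWithin_succ, derivWithin_zero_of_notMem_closure hcl, abs_zero]
        exact hZ0) hN0
  have h1 : trapezoidal_integral f N 0 (x * N) = x * Ssum f x := by
    unfold trapezoidal_integral
    rw [hf.supp 0 (by simp), hf.supp (x * N) (fun h => by linarith [h.2]),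
      hf.Ssum_eq (N := N - 1) hx (by
        rw [Nat.cast_sub (by omega)]; push_cast; linarith)]
    have : (N : ℝ) ≠ 0 := by positivity
    congr 1
    · field_simp; ring
    · simp only [zero_add, add_zero, zero_div]
      refine Finset.sum_congr rfl fun j _ => ?_
      congr 1
      field_simp; ring
  have h2 : ∫ t in (0:ℝ)..(x * N), f t = ∫ t, f t := by
    rw [intervalIntegral.integral_of_le hxN.le]
    apply setIntegral_eq_integral_of_forall_compl_eq_zero
    intro t ht
    apply hf.supp
    intro h
    exact ht ⟨by linarith [h.1], by linarith [h.2]⟩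
  unfold trapezoidal_error at key
  rw [h1, h2] at key
  refine key.trans ?_
  rw [sub_zero, abs_of_pos hxN]
  have hN' : (0 : ℝ) < N := by positivity
  rw [div_le_iff₀ (by positivity)]
  have : (x * N) ^ 3 ≤ 4 * (x * N) ^ 2 := by nlinarith [sq_nonneg (x * N)]
  nlinarith [mul_le_mul_of_nonneg_right this hZ0, mul_nonneg (sq_nonneg (x * N)) hZ0]

end GoodFn

/-! ### Bounds for `h` -/

theorem GoodFn.E_bound {f : ℝ → ℝ} (hf : GoodFn f) : ∃ M : ℝ, 0 ≤ M ∧ ∀ x, 0 < x →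
    |Ssum f x - (∫ t, f t) / x| ≤ M / x ∧ |Ssum f x - (∫ t, f t) / x| ≤ M * x := by
  obtain ⟨M1, hM1, h1⟩ := hf.Ssum_bound
  obtain ⟨M2, hM2, h2⟩ := hf.trap_bound
  set K := ∫ t, f t with hK
  have hA : ∀ x, 0 < x → |Ssum f x - K / x| ≤ (M1 + |K| + M2) / x := by
    intro x hx
    have := abs_sub (Ssum f x) (K / x)
    rw [abs_div, abs_of_pos hx] at this
    have h3 := h1 x hx
    have h4 : 0 ≤ M2 / x := by positivity
    have : (M1 + |K| + M2) / x = M1 / x + |K| / x + M2 / x := by ring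
    linarith
  refine ⟨M1 + |K| + M2, by positivity, fun x hx => ⟨hA x hx, ?_⟩⟩
  rcases le_total x 1 with h | h
  · have h3 := h2 x hx h
    have h4 : Ssum f x - K / x = (x * Ssum f x - K) / x := by field_simp
    rw [h4, abs_div, abs_of_pos hx, div_le_iff₀ hx]
    have : 0 ≤ (M1 + |K|) * x ^ 2 := by positivity
    nlinarith
  · refine (hA x hx).trans ?_
    rw [div_le_iff₀ hx]
    have h5 : 0 ≤ M1 + |K| + M2 := by positivity
    have h6 : 1 ≤ x * x := by nlinarith
    nlinarith

theorem pair_bound {f g : ℝ → ℝ} (hf : GoodFn f) (hg : GoodFn g) (hfg : ∫ t, f t = ∫ t, g t) :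
    ∃ C : ℝ, 0 ≤ C ∧ ∀ r T : ℝ, 0 < r →
      |Ssum f r - |T|⁻¹ * Ssum g (r / |T|)| ≤ C * (1 + r / (r ^ 2 + T ^ 2)) := by
  obtain ⟨M1, hM1, h1⟩ := hf.Ssum_bound
  obtain ⟨M2, hM2, h2⟩ := hf.E_bound
  obtain ⟨M3, hM3, h3⟩ := hg.E_bound
  refine ⟨M1 + M2 + 2 * M3, by positivity, fun r T hr => ?_⟩
  rcases eq_or_ne T 0 with rfl | hT
  · simp only [abs_zero, inv_zero, zero_mul, sub_zero]
    refine (h1 r hr).trans ?_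
    have : r / (r ^ 2 + 0 ^ 2) = r⁻¹ := by field_simp; simp
    rw [this, div_eq_mul_inv]
    have hr' : 0 < r⁻¹ := by positivity
    nlinarith [mul_nonneg hM2 hr'.le, mul_nonneg hM3 hr'.le]
  · have hT' : 0 < |T| := abs_pos.mpr hT
    have hx : 0 < r / |T| := by positivity
    set K := ∫ t, g t with hK
    have e : Ssum f r - |T|⁻¹ * Ssum g (r / |T|) =
        (Ssum f r - (∫ t, f t) / r) - |T|⁻¹ * (Ssum g (r / |T|) - K / (r / |T|)) := by
      rw [hfg]; field_simp; ring
    have hA : |Ssum f r - (∫ t, f t) / r| ≤ M2 := by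
      obtain ⟨ha, hb⟩ := h2 r hr
      rcases le_total r 1 with h | h
      · nlinarith
      · refine ha.trans ?_
        rw [div_le_iff₀ hr]; nlinarith
    have hB : |T|⁻¹ * |Ssum g (r / |T|) - K / (r / |T|)| ≤ 2 * M3 * (r / (r ^ 2 + T ^ 2)) := by
      obtain ⟨ha, hb⟩ := h3 _ hx
      rw [← sq_abs T]
      set t := |T|
      rcases le_total t r with h | h
      · calc t⁻¹ * |Ssum g (r / t) - K / (r / t)| ≤ t⁻¹ * (M3 / (r / t)) := by gcongr
          _ = M3 / r := by field_simp
          _ ≤ _ := by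
            rw [div_le_iff₀ hr]
            have : 1 / 2 ≤ r / (r ^ 2 + t ^ 2) * r := by
              rw [div_mul_eq_mul_div, le_div_iff₀ (by positivity)]; nlinarith
            nlinarith
      · calc t⁻¹ * |Ssum g (r / t) - K / (r / t)| ≤ t⁻¹ * (M3 * (r / t)) := by gcongr
          _ = M3 * (r / t ^ 2) := by field_simp
          _ ≤ 2 * M3 * (r / (r ^ 2 + t ^ 2)) := by
            have : r / t ^ 2 ≤ 2 * (r / (r ^ 2 + t ^ 2)) := by
              rw [← mul_div_assoc, div_le_div_iff₀ (by positivity) (by positivity)]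
              have : r ^ 2 ≤ t ^ 2 := by gcongr
              nlinarith
            nlinarith
    rw [e]
    refine (abs_sub _ _).trans ?_
    rw [abs_mul, abs_of_pos (inv_pos.mpr hT')]
    have : 0 ≤ r / (r ^ 2 + T ^ 2) := by positivity
    have h7 : 0 ≤ (M1 + M2) * (r / (r ^ 2 + T ^ 2)) := by positivity
    nlinarith

theorem psi1_eq (t : ℝ) : psi1 t = expNegInvGlue (1 - t ^ 2) := by
  unfold psi1 expNegInvGlue
  by_cases h : |t| < 1
  · rw [if_pos h, if_neg]
    have := (sq_lt_one_iff_abs_lt_one t).mpr h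
    linarith
  · rw [if_neg h, if_pos]
    have := (sq_lt_one_iff_abs_lt_one t).not.mpr h
    linarith

theorem psi1_contDiff : ContDiff ℝ (⊤ : ℕ∞) psi1 := by
  have : psi1 = fun t => expNegInvGlue (1 - t ^ 2) := funext psi1_eq
  rw [this]
  exact expNegInvGlue.contDiff.comp (contDiff_const.sub (contDiff_id.pow 2))

theorem uFn_contDiff : ContDiff ℝ (⊤ : ℕ∞) uFn :=
  contDiff_const.mul (psi1_contDiff.comp ((contDiff_const.mul contDiff_id).sub contDiff_const))

theorem uFn_zero {t : ℝ} (h : t ≤ 1 / 2 ∨ 1 ≤ t) : uFn t = 0 := by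
  unfold uFn psi1
  rw [if_neg, mul_zero]
  rw [abs_lt]
  rintro ⟨h1, h2⟩
  rcases h with h | h <;> linarith

/-- `k(t) = u(t)/t`. -/
noncomputable def kFn (t : ℝ) : ℝ := t⁻¹ * uFn t

/-- `l(s) = u(1/s)/s`. -/
noncomputable def lFn (t : ℝ) : ℝ := t⁻¹ * uFn t⁻¹

theorem lFn_zero {t : ℝ} (h : t ≤ 1 ∨ 2 ≤ t) : lFn t = 0 := by
  unfold lFn
  rw [uFn_zero, mul_zero]
  rcases h with h | h
  · rcases le_or_gt t 0 with h0 | h0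
    · left; have := inv_nonpos.mpr h0; linarith
    · right; exact (one_le_inv₀ h0).mpr h
  · left
    rw [one_div]; exact inv_anti₀ (by norm_num) h

theorem kFn_zero {t : ℝ} (h : t ≤ 1 / 2 ∨ 1 ≤ t) : kFn t = 0 := by
  unfold kFn
  rw [uFn_zero h, mul_zero]

theorem kFn_good : GoodFn kFn where
  smooth := by
    rw [contDiff_iff_contDiffAt]
    intro t
    rcases lt_or_ge 0 t with h | h
    · exact (contDiffAt_inv ℝ h.ne').mul uFn_contDiff.contDiffAt
    · refine (contDiffAt_const (c := (0 : ℝ))).congr_of_eventuallyEq ?_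
      filter_upwards [gt_mem_nhds (show t < 1 / 2 by linarith)] with s hs
      exact kFn_zero (Or.inl hs.le)
  supp := by
    intro t ht
    apply kFn_zero
    by_contra! h
    exact ht ⟨h.1.le, by linarith [h.2]⟩

theorem lFn_good : GoodFn lFn where
  smooth := by
    rw [contDiff_iff_contDiffAt]
    intro t
    rcases lt_or_ge 0 t with h | h
    · exact (contDiffAt_inv ℝ h.ne').mul
        (uFn_contDiff.contDiffAt.comp t (contDiffAt_inv ℝ h.ne'))
    · refine (contDiffAt_const (c := (0 : ℝ))).congr_of_eventuallyEq ?_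
      filter_upwards [gt_mem_nhds (show t < 1 by linarith)] with s hs
      exact lFn_zero (Or.inl hs.le)
  supp := by
    intro t ht
    apply lFn_zero
    by_contra! h
    exact ht ⟨by linarith [h.1], h.2.le⟩

theorem integral_kFn_eq : ∫ t, kFn t = ∫ t, lFn t := by
  have hk : ∫ t in Set.Ioi (0 : ℝ), kFn t = ∫ t, kFn t := by
    apply setIntegral_eq_integral_of_forall_compl_eq_zero
    intro t ht
    exact kFn_zero (Or.inl (by simp at ht; linarith))
  have hl : ∫ t in Set.Ioi (0 : ℝ), lFn t = ∫ t, lFn t := by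
    apply setIntegral_eq_integral_of_forall_compl_eq_zero
    intro t ht
    exact lFn_zero (Or.inl (by simp at ht; linarith))
  rw [← hk, ← hl, ← integral_comp_rpow_Ioi kFn (show (-1 : ℝ) ≠ 0 by norm_num)]
  refine setIntegral_congr_fun measurableSet_Ioi fun t ht => ?_
  have ht' : (0 : ℝ) < t := ht
  simp only [kFn, lFn, smul_eq_mul, Real.rpow_neg_one, inv_inv]
  rw [show (-1 - 1 : ℝ) = ((-2 : ℤ) : ℝ) by norm_num, Real.rpow_intCast]
  rw [zpow_neg]
  norm_num
  field_simp

theorem hFn_eq {x : ℝ} (hx : 0 < x) (y : ℝ) :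
    hFn x y = Ssum kFn x - |y|⁻¹ * Ssum lFn (x / |y|) := by
  unfold hFn Ssum
  rw [← tsum_mul_left, ← (kFn_good.summable' x).tsum_sub ((lFn_good.summable' (x / |y|)).mul_left _)]
  refine tsum_congr fun j => ?_
  have hj : (0 : ℝ) < (j : ℝ) + 1 := by positivity
  rcases eq_or_ne y 0 with rfl | hy
  · simp only [abs_zero, zero_div, inv_zero, zero_mul, sub_zero, kFn]
    rw [uFn_zero (t := 0) (by norm_num), sub_zero]
  · have hy' : 0 < |y| := abs_pos.mpr hy
    unfold kFn lFn
    have : (x / |y| * ((j : ℝ) + 1))⁻¹ = |y| / (x * ((j : ℝ) + 1)) := by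
      field_simp
    rw [this]
    field_simp

/-- `r ∂h/∂r (r, T)`. -/
noncomputable def hD1 (r T : ℝ) : ℝ := Ssum (tD kFn) r - |T|⁻¹ * Ssum (tD lFn) (r / |T|)

/-- `r d/dr` of `h(r, r²T)`, at `r, r²T`. -/
noncomputable def hD2 (r T : ℝ) : ℝ :=
  Ssum (tD kFn) r - |T|⁻¹ * Ssum (fun t => (-2) * lFn t + (-1) * tD lFn t) (r / |T|)

theorem hasDerivAt_hFn {r : ℝ} (hr : 0 < r) (T : ℝ) :
    HasDerivAt (fun s => hFn s T) (r⁻¹ * hD1 r T) r := by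
  have he : (fun s => hFn s T) =ᶠ[nhds r]
      fun s => Ssum kFn s - |T|⁻¹ * Ssum lFn (s / |T|) := by
    filter_upwards [lt_mem_nhds hr] with s hs using hFn_eq hs T
  refine HasDerivAt.congr_of_eventuallyEq ?_ he
  unfold hD1
  rcases eq_or_ne T 0 with rfl | hT
  · simp only [abs_zero, inv_zero, zero_mul, sub_zero]
    exact kFn_good.hasDerivAt_Ssum hr
  · have hT' : 0 < |T| := abs_pos.mpr hT
    have h1 := (lFn_good.hasDerivAt_Ssum (show 0 < r / |T| by positivity)).comp r
      ((hasDerivAt_id' r).div_const |T|)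
    refine ((kFn_good.hasDerivAt_Ssum hr).sub (h1.const_mul (|T|⁻¹))).congr_deriv ?_
    field_simp

theorem Ssum_lin {f g : ℝ → ℝ} (hf : GoodFn f) (hg : GoodFn g) (a b x : ℝ) :
    Ssum (fun t => a * f t + b * g t) x = a * Ssum f x + b * Ssum g x := by
  unfold Ssum
  rw [← tsum_mul_left, ← tsum_mul_left,
    ← ((hf.summable' x).mul_left a).tsum_add ((hg.summable' x).mul_left b)]

theorem hasDerivAt_hFn_scaled {r : ℝ} (hr : 0 < r) (T : ℝ) :
    HasDerivAt (fun s => hFn s (s ^ 2 * T)) (r⁻¹ * hD2 r (r ^ 2 * T)) r := by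
  have he : (fun s => hFn s (s ^ 2 * T)) =ᶠ[nhds r]
      fun s => Ssum kFn s - ((s ^ 2)⁻¹ * |T|⁻¹) * Ssum lFn (s⁻¹ * |T|⁻¹) := by
    filter_upwards [lt_mem_nhds hr] with s hs
    rw [hFn_eq hs, abs_mul, abs_of_pos (show 0 < s ^ 2 by positivity), mul_inv]
    congr 3
    rcases eq_or_ne T 0 with rfl | hT
    · simp
    · have hT' : 0 < |T| := abs_pos.mpr hT
      field_simp
  refine HasDerivAt.congr_of_eventuallyEq ?_ he
  unfold hD2
  rw [Ssum_lin lFn_good lFn_good.tD]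
  rcases eq_or_ne T 0 with rfl | hT
  · simp only [abs_zero, mul_zero, inv_zero, zero_mul, sub_zero]
    exact kFn_good.hasDerivAt_Ssum hr
  · have hT' : 0 < |T| := abs_pos.mpr hT
    have h1 := (lFn_good.hasDerivAt_Ssum (show 0 < r⁻¹ * |T|⁻¹ by positivity)).comp r
      ((hasDerivAt_inv hr.ne').mul_const |T|⁻¹)
    have h2 := ((hasDerivAt_pow 2 r).fun_inv (by positivity)).mul_const |T|⁻¹
    refine ((kFn_good.hasDerivAt_Ssum hr).sub (h2.mul h1)).congr_deriv ?_
    have e1 : r / |r ^ 2 * T| = r⁻¹ * |T|⁻¹ := by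
      rw [abs_mul, abs_of_pos (show 0 < r ^ 2 by positivity)]; field_simp
    rw [e1, abs_mul, abs_of_pos (show 0 < r ^ 2 by positivity)]
    simp only [Function.comp]
    field_simp
    ring

theorem h_bounds : ∃ C : ℝ, 0 ≤ C ∧ ∀ r T : ℝ, 0 < r →
    |hFn r T| ≤ C * (1 + r / (r ^ 2 + T ^ 2)) ∧
    |hD1 r T| ≤ C * (1 + r / (r ^ 2 + T ^ 2)) ∧
    |hD2 r T| ≤ C * (1 + r / (r ^ 2 + T ^ 2)) := by
  obtain ⟨C1, h1, hC1⟩ := pair_bound kFn_good lFn_good integral_kFn_eq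
  obtain ⟨C2, h2, hC2⟩ := pair_bound kFn_good.tD lFn_good.tD
    (by rw [kFn_good.integral_tD, lFn_good.integral_tD, integral_kFn_eq])
  obtain ⟨C3, h3, hC3⟩ := pair_bound kFn_good.tD (lFn_good.linComb lFn_good.tD (-2) (-1)) (by
    rw [integral_add (lFn_good.integrable.const_mul _) (lFn_good.tD.integrable.const_mul _),
      integral_const_mul, integral_const_mul, kFn_good.integral_tD, lFn_good.integral_tD,
      integral_kFn_eq]
    ring)
  refine ⟨C1 + C2 + C3, by positivity, fun r T hr => ?_⟩
  have hp : 0 ≤ 1 + r / (r ^ 2 + T ^ 2) := by positivity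
  refine ⟨?_, ?_, ?_⟩
  · rw [hFn_eq hr]
    exact (hC1 r T hr).trans (mul_le_mul_of_nonneg_right (by linarith) hp)
  · exact (hC2 r T hr).trans (mul_le_mul_of_nonneg_right (by linarith) hp)
  · exact (hC3 r T hr).trans (mul_le_mul_of_nonneg_right (by linarith) hp)

theorem measurable_pair {f g : ℝ → ℝ} (hg : GoodFn g) (r : ℝ) :
    Measurable (fun T => Ssum f r - |T|⁻¹ * Ssum g (r / |T|)) := by
  have := hg.measurable_Ssum
  have h1 : Measurable (fun T : ℝ => |T|) := continuous_abs.measurable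
  exact measurable_const.sub (h1.inv.mul (this.comp (measurable_const.div h1)))

theorem measurable_hFn {r : ℝ} (hr : 0 < r) : Measurable (fun T => hFn r T) := by
  simp_rw [hFn_eq hr]
  exact measurable_pair lFn_good r

theorem measurable_hD1 (r : ℝ) : Measurable (fun T => hD1 r T) :=
  measurable_pair lFn_good.tD r

theorem measurable_hD2 (r : ℝ) : Measurable (fun T => hD2 r T) :=
  measurable_pair (lFn_good.linComb lFn_good.tD (-2) (-1)) r

/-! ### The measure estimate -/

theorem radial_lintegral (r T : ℝ) (hr : 0 < r) :
    ∫⁻ ρ in Set.Ioi (0 : ℝ), ENNReal.ofReal (ρ * (r / (r ^ 2 + (T + ρ ^ 2) ^ 2))) ≤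
      ENNReal.ofReal (Real.pi / 2) := by
  have hd : ∀ ρ ∈ Set.Ici (0 : ℝ), HasDerivAt (fun ρ => (1 / 2) * Real.arctan ((T + ρ ^ 2) / r))
      (ρ * (r / (r ^ 2 + (T + ρ ^ 2) ^ 2))) ρ := by
    intro ρ _
    have h1 := (((hasDerivAt_pow 2 ρ).const_add T).div_const r).arctan.const_mul (1 / 2 : ℝ)
    refine h1.congr_deriv ?_
    have : 0 < r ^ 2 + (T + ρ ^ 2) ^ 2 := by positivity
    field_simp
    ring
  have hpos : ∀ ρ ∈ Set.Ioi (0 : ℝ), 0 ≤ ρ * (r / (r ^ 2 + (T + ρ ^ 2) ^ 2)) := by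
    intro ρ hρ
    have : (0 : ℝ) < ρ := hρ
    positivity
  have hlim : Tendsto (fun ρ : ℝ => (1 / 2) * Real.arctan ((T + ρ ^ 2) / r)) atTop
      (nhds ((1 / 2) * (Real.pi / 2))) := by
    refine Tendsto.const_mul _ ?_
    refine (Real.tendsto_arctan_atTop.mono_right nhdsWithin_le_nhds).comp ?_
    exact (tendsto_atTop_add_const_left _ T (tendsto_pow_atTop two_ne_zero)).atTop_div_const hr
  have hIntg := integrableOn_Ioi_deriv_of_nonneg' hd hpos hlim
  have hval := integral_Ioi_of_hasDerivAt_of_nonneg' hd hpos hlim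
  rw [← ofReal_integral_eq_lintegral_ofReal hIntg
    ((ae_restrict_mem measurableSet_Ioi).mono fun ρ hρ => hpos ρ hρ), hval]
  apply ENNReal.ofReal_le_ofReal
  have := Real.neg_pi_div_two_lt_arctan ((T + 0 ^ 2) / r)
  linarith

theorem plane_lintegral (r T : ℝ) (hr : 0 < r) :
    ∫⁻ p : ℝ × ℝ, ENNReal.ofReal (r / (r ^ 2 + (T + (p.1 ^ 2 + p.2 ^ 2)) ^ 2)) ≤
      ENNReal.ofReal (Real.pi ^ 2) := by
  rw [← lintegral_comp_polarCoord_symm, polarCoord_target]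
  have h1 : ∀ p ∈ Set.Ioi (0 : ℝ) ×ˢ Set.Ioo (-Real.pi) Real.pi,
      ENNReal.ofReal p.1 • ENNReal.ofReal (r / (r ^ 2 + (T + ((polarCoord.symm p).1 ^ 2 +
        (polarCoord.symm p).2 ^ 2)) ^ 2)) =
      ENNReal.ofReal (p.1 * (r / (r ^ 2 + (T + p.1 ^ 2) ^ 2))) * 1 := by
    rintro ⟨ρ, θ⟩ ⟨hρ, -⟩
    have hρ' : (0 : ℝ) < ρ := hρ
    simp only [polarCoord_symm_apply, smul_eq_mul, mul_one]
    rw [← ENNReal.ofReal_mul hρ'.le]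
    congr 4
    have := Real.cos_sq_add_sin_sq θ
    congr 2
    linear_combination ρ ^ 2 * this
  rw [setLIntegral_congr_fun (measurableSet_Ioi.prod measurableSet_Ioo) h1,
    Measure.volume_eq_prod, ← Measure.prod_restrict]
  rw [lintegral_prod_mul (f := fun ρ => ENNReal.ofReal (ρ * (r / (r ^ 2 + (T + ρ ^ 2) ^ 2))))
    (g := fun _ => 1)]
  · calc _ ≤ ENNReal.ofReal (Real.pi / 2) * ENNReal.ofReal (2 * Real.pi) := by
          gcongr
          · exact radial_lintegral r T hr
          · rw [lintegral_one, Measure.restrict_apply_univ, Real.volume_Ioo]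
            apply le_of_eq; congr 1; ring
      _ = ENNReal.ofReal (Real.pi ^ 2) := by
          rw [← ENNReal.ofReal_mul (by positivity)]
          congr 1; ring
  · exact Measurable.aemeasurable (by fun_prop)
  · exact aemeasurable_const

theorem plane_lintegral' (r T σ : ℝ) (hr : 0 < r) (hσ : σ = 1 ∨ σ = -1) :
    ∫⁻ a : ℝ, ∫⁻ b : ℝ, ENNReal.ofReal (r / (r ^ 2 + (T + σ * (a ^ 2 + b ^ 2)) ^ 2)) ≤
      ENNReal.ofReal (Real.pi ^ 2) := by
  have h : ∀ a b : ℝ, (T + σ * (a ^ 2 + b ^ 2)) ^ 2 = (σ * T + (a ^ 2 + b ^ 2)) ^ 2 := by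
    intro a b
    rcases hσ with rfl | rfl <;> ring
  simp_rw [h]
  have := plane_lintegral r (σ * T) hr
  rwa [Measure.volume_eq_prod, lintegral_prod] at this
  exact Measurable.aemeasurable (by fun_prop)

/-- A diagonal form with coefficients `ε`. -/
noncomputable def GG (ε : Fin 4 → ℝ) (y : Fin 4 → ℝ) : ℝ := ∑ i, ε i * y i ^ 2

theorem GG_continuous (ε : Fin 4 → ℝ) : Continuous (GG ε) := by
  unfold GG; fun_prop

theorem GG_update (ε x : Fin 4 → ℝ) {i j : Fin 4} (hij : i ≠ j) (hε : ε i = ε j) (a b : ℝ) :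
    GG ε (Function.update (Function.update x i a) j b) =
      (∑ k ∈ (Finset.univ.erase i).erase j, ε k * x k ^ 2) + ε i * (a ^ 2 + b ^ 2) := by
  unfold GG
  rw [← Finset.add_sum_erase _ _ (Finset.mem_univ i),
    ← Finset.add_sum_erase (Finset.univ.erase i) _ (Finset.mem_erase.mpr ⟨hij.symm, Finset.mem_univ j⟩)]
  have : ∑ k ∈ (Finset.univ.erase i).erase j,
      ε k * Function.update (Function.update x i a) j b k ^ 2 =
      ∑ k ∈ (Finset.univ.erase i).erase j, ε k * x k ^ 2 := by
    refine Finset.sum_congr rfl fun k hk => ?_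
    simp only [Finset.mem_erase] at hk
    rw [Function.update_of_ne hk.1, Function.update_of_ne hk.2.1]
  rw [this, Function.update_of_ne hij, Function.update_self, Function.update_self, hε]
  ring

theorem box_lintegral (ε : Fin 4 → ℝ) (hε : ∀ i, ε i = 1 ∨ ε i = -1) (r : ℝ) (hr : 0 < r) :
    ∫⁻ y : Fin 4 → ℝ, (Metric.closedBall (0 : Fin 4 → ℝ) 2).indicator
      (fun y => ENNReal.ofReal (r / (r ^ 2 + (GG ε y) ^ 2))) y ≤
      ENNReal.ofReal (256 * Real.pi ^ 2) := by
  obtain ⟨i, j, hij, he⟩ : ∃ i j : Fin 4, i ≠ j ∧ ε i = ε j := by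
    rcases hε 0 with h0 | h0 <;> rcases hε 1 with h1 | h1 <;> rcases hε 2 with h2 | h2
    all_goals first
      | exact ⟨0, 1, by decide, h0.trans h1.symm⟩
      | exact ⟨0, 2, by decide, h0.trans h2.symm⟩
      | exact ⟨1, 2, by decide, h1.trans h2.symm⟩
  have hGm : Measurable (GG ε) := (GG_continuous ε).measurable
  set f : (Fin 4 → ℝ) → ENNReal := (Metric.closedBall (0 : Fin 4 → ℝ) 2).indicator
      (fun y => ENNReal.ofReal (r / (r ^ 2 + (GG ε y) ^ 2))) with hf
  set g : (Fin 4 → ℝ) → ENNReal := (Metric.closedBall (0 : Fin 4 → ℝ) 2).indicator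
      (fun _ => ENNReal.ofReal (Real.pi ^ 2)) with hg
  have hfm : Measurable f := Measurable.indicator (by fun_prop) Metric.isClosed_closedBall.measurableSet
  have hgm : Measurable g := measurable_const.indicator Metric.isClosed_closedBall.measurableSet
  have hmem : ∀ y : Fin 4 → ℝ, y ∈ Metric.closedBall (0 : Fin 4 → ℝ) 2 ↔ ∀ k, |y k| ≤ 2 := by
    intro y
    rw [mem_closedBall_zero_iff, pi_norm_le_iff_of_nonneg (by norm_num)]
    rfl
  have hform : ∀ (F : (Fin 4 → ℝ) → ENNReal) (_ : Measurable F) (x : Fin 4 → ℝ),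
      (lmarginal (fun _ => volume) {i, j} F) x =
        ∫⁻ a : ℝ, ∫⁻ b : ℝ, F (Function.update (Function.update x i a) j b) := by
    intro F hF x
    rw [lmarginal_insert F hF (by simpa using hij)]
    simp only [lmarginal_singleton]
  have key : ∫⁻ y, f y ≤ ∫⁻ y, g y := by
    refine lintegral_le_of_lmarginal_le (μ := fun _ : Fin 4 => (volume : Measure ℝ)) {i, j} hfm hgm ?_
    intro x
    rw [hform f hfm, hform g hgm]
    by_cases hx : ∀ k, k ≠ i → k ≠ j → |x k| ≤ 2
    · calc ∫⁻ a : ℝ, ∫⁻ b : ℝ, f (Function.update (Function.update x i a) j b)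
          ≤ ∫⁻ a : ℝ, ∫⁻ b : ℝ, ENNReal.ofReal (r / (r ^ 2 +
            ((∑ k ∈ (Finset.univ.erase i).erase j, ε k * x k ^ 2) +
              ε i * (a ^ 2 + b ^ 2)) ^ 2)) := by
            refine lintegral_mono fun a => lintegral_mono fun b => ?_
            rw [hf]
            refine (Set.indicator_le_self _ _ _).trans ?_
            rw [GG_update ε x hij he]
        _ ≤ ENNReal.ofReal (Real.pi ^ 2) := plane_lintegral' r _ _ hr (hε i)
        _ = ∫⁻ a in Set.Icc (0 : ℝ) 1, ∫⁻ b in Set.Icc (0 : ℝ) 1,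
              ENNReal.ofReal (Real.pi ^ 2) := by simp
        _ ≤ ∫⁻ a : ℝ, ∫⁻ b : ℝ, g (Function.update (Function.update x i a) j b) := by
            rw [← lintegral_indicator measurableSet_Icc]
            refine lintegral_mono fun a => ?_
            refine Set.indicator_apply_le' (fun ha => ?_) (fun _ => zero_le)
            rw [← lintegral_indicator measurableSet_Icc]
            refine lintegral_mono fun b => ?_
            refine Set.indicator_apply_le' (fun hb => ?_) (fun _ => zero_le)
            rw [hg, Set.indicator_of_mem]
            rw [hmem]
            intro k
            by_cases hkj : k = j
            · subst hkj
              rw [Function.update_self, abs_le]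
              exact ⟨by linarith [hb.1], by linarith [hb.2]⟩
            · rw [Function.update_of_ne hkj]
              by_cases hki : k = i
              · subst hki
                rw [Function.update_self, abs_le]
                exact ⟨by linarith [ha.1], by linarith [ha.2]⟩
              · rw [Function.update_of_ne hki]
                exact hx k hki hkj
    · push Not at hx
      obtain ⟨k, hki, hkj, hk⟩ := hx
      have : ∀ a b, f (Function.update (Function.update x i a) j b) = 0 := by
        intro a b
        rw [hf, Set.indicator_of_notMem]
        rw [hmem]
        intro h
        have := h k
        rw [Function.update_of_ne hkj, Function.update_of_ne hki] at this
        linarith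
      simp [this]
  refine key.trans ?_
  rw [hg, lintegral_indicator Metric.isClosed_closedBall.measurableSet, setLIntegral_const,
    Real.volume_pi_closedBall _ (by norm_num), ← ENNReal.ofReal_mul (by positivity)]
  apply ENNReal.ofReal_le_ofReal
  simp only [Fintype.card_fin]
  linarith

/-- The majorant. -/
noncomputable def Phi (ε : Fin 4 → ℝ) (r : ℝ) (y : Fin 4 → ℝ) : ℝ :=
  (Metric.closedBall (0 : Fin 4 → ℝ) 2).indicator
    (fun y => 1 + r / (r ^ 2 + (GG ε y) ^ 2)) y

theorem Phi_nonneg (ε : Fin 4 → ℝ) {r : ℝ} (hr : 0 < r) (y : Fin 4 → ℝ) : 0 ≤ Phi ε r y :=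
  Set.indicator_nonneg (fun _ _ => by positivity) _

theorem Phi_integrable (ε : Fin 4 → ℝ) {r : ℝ} (hr : 0 < r) : Integrable (Phi ε r) := by
  unfold Phi
  rw [integrable_indicator_iff Metric.isClosed_closedBall.measurableSet]
  refine ContinuousOn.integrableOn_compact (isCompact_closedBall _ _) (Continuous.continuousOn ?_)
  have := GG_continuous ε
  exact continuous_const.add (continuous_const.div (by fun_prop) (fun y => by positivity))

theorem Phi_integral (ε : Fin 4 → ℝ) (hε : ∀ i, ε i = 1 ∨ ε i = -1) {r : ℝ} (hr : 0 < r) :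
    ∫ y, Phi ε r y ≤ 256 + 256 * Real.pi ^ 2 := by
  rw [integral_eq_lintegral_of_nonneg_ae (Eventually.of_forall (Phi_nonneg ε hr))
    (Phi_integrable ε hr).1]
  refine ENNReal.toReal_le_of_le_ofReal (by positivity) ?_
  have h : ∀ y, ENNReal.ofReal (Phi ε r y) =
      (Metric.closedBall (0 : Fin 4 → ℝ) 2).indicator (fun _ => 1) y +
      (Metric.closedBall (0 : Fin 4 → ℝ) 2).indicator
      (fun y => ENNReal.ofReal (r / (r ^ 2 + (GG ε y) ^ 2))) y := by
    intro y
    unfold Phi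
    by_cases hy : y ∈ Metric.closedBall (0 : Fin 4 → ℝ) 2
    · simp only [Set.indicator_of_mem hy]
      rw [ENNReal.ofReal_add (by norm_num) (by positivity), ENNReal.ofReal_one]
    · simp [Set.indicator_of_notMem hy]
  simp_rw [h]
  rw [lintegral_add_left (measurable_const.indicator Metric.isClosed_closedBall.measurableSet),
    ENNReal.ofReal_add (by norm_num) (by positivity)]
  gcongr
  · rw [lintegral_indicator Metric.isClosed_closedBall.measurableSet, setLIntegral_const,
      Real.volume_pi_closedBall _ (by norm_num), one_mul]
    apply ENNReal.ofReal_le_ofReal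
    simp only [Fintype.card_fin]
    norm_num
  · exact box_lintegral ε hε r hr

/-! ### The normalised integral -/

theorem norm_eC (t : ℝ) : ‖eC t‖ = 1 := by
  unfold eC
  rw [show (2 * Real.pi * Complex.I * t : ℂ) = ((2 * Real.pi * t : ℝ) : ℂ) * Complex.I by
    push_cast; ring]
  exact Complex.norm_exp_ofReal_mul_I _

theorem eC_continuous : Continuous eC := by
  unfold eC; fun_prop

theorem deriv_under (R R' : ℝ → (Fin 4 → ℝ) → ℝ) (E : (Fin 4 → ℝ) → ℂ) (hE : Continuous E)
    (hE1 : ∀ z, ‖E z‖ = 1) {r : ℝ} (hr : 0 < r) (ρ K : ℝ)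
    (hRm : ∀ s, 0 < s → Measurable (R s)) (hR'm : Measurable (R' r))
    (hd : ∀ s, 0 < s → ∀ z, HasDerivAt (fun s => R s z) (R' s z) s)
    (hb0 : ∀ z, |R r z| ≤ (Metric.closedBall (0 : Fin 4 → ℝ) ρ).indicator (fun _ => K) z)
    (hb : ∀ s, r / 2 < s → ∀ z,
      |R' s z| ≤ (Metric.closedBall (0 : Fin 4 → ℝ) ρ).indicator (fun _ => K) z) :
    HasDerivAt (fun s => ∫ z, (R s z : ℂ) * E z) (∫ z, (R' r z : ℂ) * E z) r := by
  have hIntg : Integrable ((Metric.closedBall (0 : Fin 4 → ℝ) ρ).indicator (fun _ => K)) := by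
    rw [integrable_indicator_iff Metric.isClosed_closedBall.measurableSet]
    exact ContinuousOn.integrableOn_compact (isCompact_closedBall _ _) continuousOn_const
  have hm : ∀ g : (Fin 4 → ℝ) → ℝ, Measurable g →
      AEStronglyMeasurable (fun z => (g z : ℂ) * E z) volume := fun g hg =>
    ((Complex.measurable_ofReal.comp hg).mul hE.measurable).aestronglyMeasurable
  have hnorm : ∀ (x : ℝ) z, ‖(x : ℂ) * E z‖ = |x| := by
    intro x z
    rw [norm_mul, hE1, mul_one, Complex.norm_real, Real.norm_eq_abs]
  refine (hasDerivAt_integral_of_dominated_loc_of_deriv_le (μ := volume)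
    (F := fun s z => (R s z : ℂ) * E z)
    (F' := fun s z => (R' s z : ℂ) * E z)
    (bound := (Metric.closedBall (0 : Fin 4 → ℝ) ρ).indicator (fun _ => K))
    (s := Set.Ioi (r / 2)) (Ioi_mem_nhds (by linarith)) ?_ ?_ ?_ ?_ hIntg ?_).2
  · filter_upwards [lt_mem_nhds hr] with s hs using hm _ (hRm s hs)
  · refine hIntg.mono' (hm _ (hRm r hr)) (Eventually.of_forall fun z => ?_)
    rw [hnorm]; exact hb0 z
  · exact hm _ hR'm
  · refine Eventually.of_forall fun z s hs => ?_
    rw [hnorm]; exact hb s hs z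
  · refine Eventually.of_forall fun z s hs => ?_
    have hs' : r / 2 < s := hs
    exact (HasDerivAt.ofReal_comp (hd s (by linarith) z)).mul_const (E z)

/-- Radial profiles. -/
structure Profile (φ : ℝ → ℝ) (L : ℝ) : Prop where
  diff : Differentiable ℝ φ
  nonneg : ∀ t, 0 ≤ φ t
  le_one : ∀ t, φ t ≤ 1
  supp : ∀ t, 3 / 2 ≤ t → φ t = 0
  dbound : ∀ t, |deriv φ t| ≤ L

theorem Profile.dsupp {φ : ℝ → ℝ} {L : ℝ} (h : Profile φ L) {t : ℝ} (ht : 2 < t) :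
    deriv φ t = 0 := by
  have : φ =ᶠ[nhds t] fun _ => 0 := by
    filter_upwards [lt_mem_nhds (show 3 / 2 < t by linarith)] with s hs using h.supp s hs.le
  rw [this.deriv_eq]; simp

/-- The normalised integral. -/
noncomputable def JJ (φ : ℝ → ℝ) (ε v : Fin 4 → ℝ) (r : ℝ) : ℂ :=
  ∫ y : Fin 4 → ℝ, ((φ ‖y‖ * hFn r (GG ε y) : ℝ) : ℂ) * eC (-(∑ i, v i * y i) / r)

theorem GG_smul (ε z : Fin 4 → ℝ) (s : ℝ) : GG ε (s • z) = s ^ 2 * GG ε z := by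
  unfold GG
  rw [Finset.mul_sum]
  refine Finset.sum_congr rfl fun i _ => ?_
  simp only [Pi.smul_apply, smul_eq_mul]; ring

theorem prof_mul_le {φ : ℝ → ℝ} {L : ℝ} (hφ : Profile φ L) {C r x : ℝ} (ε y : Fin 4 → ℝ)
    (hr : 0 < r) (hC : 0 ≤ C) (hx : |x| ≤ C * (1 + r / (r ^ 2 + (GG ε y) ^ 2))) :
    |φ ‖y‖ * x| ≤ C * Phi ε r y := by
  unfold Phi
  by_cases hy : y ∈ Metric.closedBall (0 : Fin 4 → ℝ) 2
  · rw [Set.indicator_of_mem hy, abs_mul, abs_of_nonneg (hφ.nonneg _)]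
    calc φ ‖y‖ * |x| ≤ 1 * |x| := by gcongr; exact hφ.le_one _
      _ ≤ _ := by rw [one_mul]; exact hx
  · rw [Set.indicator_of_notMem hy, hφ.supp, zero_mul, abs_zero, mul_zero]
    rw [mem_closedBall_zero_iff] at hy
    linarith

theorem dprof_mul_le {φ : ℝ → ℝ} {L : ℝ} (hφ : Profile φ L) {C r x : ℝ} (ε y : Fin 4 → ℝ)
    (hr : 0 < r) (hC : 0 ≤ C) (hx : |x| ≤ C * (1 + r / (r ^ 2 + (GG ε y) ^ 2))) :
    |‖y‖ * deriv φ ‖y‖ * x| ≤ 2 * L * C * Phi ε r y := by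
  have hL : 0 ≤ L := (abs_nonneg _).trans (hφ.dbound 0)
  unfold Phi
  by_cases hy : y ∈ Metric.closedBall (0 : Fin 4 → ℝ) 2
  · rw [Set.indicator_of_mem hy, abs_mul, abs_mul, abs_of_nonneg (norm_nonneg y)]
    rw [mem_closedBall_zero_iff] at hy
    calc ‖y‖ * |deriv φ ‖y‖| * |x| ≤ 2 * L * |x| := by gcongr; exact hφ.dbound _
      _ ≤ 2 * L * (C * (1 + r / (r ^ 2 + (GG ε y) ^ 2))) := by gcongr
      _ = _ := by ring
  · rw [Set.indicator_of_notMem hy, hφ.dsupp, mul_zero, zero_mul, abs_zero, mul_zero]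
    rw [mem_closedBall_zero_iff] at hy
    linarith

theorem Phi_le (ε y : Fin 4 → ℝ) {r s : ℝ} (hr : 0 < r) (hs : r / 2 < s) :
    Phi ε s y ≤ (Metric.closedBall (0 : Fin 4 → ℝ) 2).indicator (fun _ => 1 + 2 / r) y := by
  unfold Phi
  apply Set.indicator_le_indicator
  have hs0 : 0 < s := by linarith
  have : s / (s ^ 2 + (GG ε y) ^ 2) ≤ 2 / r := by
    rw [div_le_div_iff₀ (by positivity) hr]
    nlinarith [sq_nonneg (GG ε y)]
  linarith

theorem JJ_bound_aux {φ : ℝ → ℝ} {L : ℝ} (hφ : Profile φ L) {C : ℝ} (hC : 0 ≤ C)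
    (ε v : Fin 4 → ℝ) (hε : ∀ i, ε i = 1 ∨ ε i = -1) {r : ℝ} (hr : 0 < r) (k : ℝ → ℝ)
    (hk : ∀ T, |k T| ≤ C * (1 + r / (r ^ 2 + T ^ 2))) :
    ‖∫ y : Fin 4 → ℝ, ((φ ‖y‖ * k (GG ε y) : ℝ) : ℂ) * eC (-(∑ i, v i * y i) / r)‖ ≤
      C * (256 + 256 * Real.pi ^ 2) := by
  have h1 := norm_integral_le_of_norm_le ((Phi_integrable ε hr).const_mul C)
    (f := fun y : Fin 4 → ℝ => ((φ ‖y‖ * k (GG ε y) : ℝ) : ℂ) * eC (-(∑ i, v i * y i) / r))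
    (Eventually.of_forall fun y => by
      rw [norm_mul, norm_eC, mul_one, Complex.norm_real, Real.norm_eq_abs]
      exact prof_mul_le hφ ε y hr hC (hk _))
  refine h1.trans ?_
  rw [integral_const_mul]
  exact mul_le_mul_of_nonneg_left (Phi_integral ε hε hr) hC

theorem JJ_deriv_zero {φ : ℝ → ℝ} {L : ℝ} (hφ : Profile φ L)
    {C : ℝ} (hC : 0 ≤ C) (hCb : ∀ r T : ℝ, 0 < r →
    |hFn r T| ≤ C * (1 + r / (r ^ 2 + T ^ 2)) ∧
    |hD1 r T| ≤ C * (1 + r / (r ^ 2 + T ^ 2)) ∧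
    |hD2 r T| ≤ C * (1 + r / (r ^ 2 + T ^ 2)))
    (ε : Fin 4 → ℝ) (hε : ∀ i, ε i = 1 ∨ ε i = -1) {r : ℝ} (hr : 0 < r) :
    ∃ D : ℂ, HasDerivAt (JJ φ ε 0) D r ∧ ‖(r : ℂ) * D‖ ≤ C * (256 + 256 * Real.pi ^ 2) := by
  have hJ : JJ φ ε 0 = fun s => ∫ z : Fin 4 → ℝ, ((φ ‖z‖ * hFn s (GG ε z) : ℝ) : ℂ) * eC 0 := by
    funext s
    simp [JJ]
  have hmφ : Measurable fun y : Fin 4 → ℝ => φ ‖y‖ :=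
    (hφ.diff.continuous.comp continuous_norm).measurable
  have hmG := (GG_continuous ε).measurable
  have hdom : ∀ s, r / 2 < s → ∀ (k : ℝ) (z : Fin 4 → ℝ), |k| ≤ C * (1 + s / (s ^ 2 + (GG ε z) ^ 2)) →
      ∀ b : ℝ, 0 ≤ b → b ≤ 1 + 2 / r → |φ ‖z‖ * (b * k)| ≤ (Metric.closedBall (0 : Fin 4 → ℝ) 2).indicator
        (fun _ => (1 + 2 / r) * (C * (1 + 2 / r))) z := by
    intro s hs k z hk b hb0 hb
    have h1 := prof_mul_le hφ ε z (by linarith) hC hk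
    have h2 := Phi_le ε z hr hs
    have h3 : (Metric.closedBall (0 : Fin 4 → ℝ) 2).indicator
        (fun _ => (1 + 2 / r) * (C * (1 + 2 / r))) z = (1 + 2 / r) * (C *
        (Metric.closedBall (0 : Fin 4 → ℝ) 2).indicator (fun _ => (1 + 2 / r)) z) := by
      by_cases hz : z ∈ Metric.closedBall (0 : Fin 4 → ℝ) 2
      · simp only [Set.indicator_of_mem hz]
      · simp only [Set.indicator_of_notMem hz, mul_zero]
    rw [h3, mul_left_comm, abs_mul, abs_of_nonneg hb0]
    exact mul_le_mul hb (h1.trans (mul_le_mul_of_nonneg_left h2 hC)) (abs_nonneg _) (by positivity)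
  have key := deriv_under (fun s z => φ ‖z‖ * hFn s (GG ε z))
    (fun s z => φ ‖z‖ * (s⁻¹ * hD1 s (GG ε z))) (fun _ => eC 0) continuous_const
    (fun _ => norm_eC 0) hr 2 ((1 + 2 / r) * (C * (1 + 2 / r)))
    (fun s hs => hmφ.mul ((measurable_hFn hs).comp hmG))
    (hmφ.mul (((measurable_hD1 r).comp hmG).const_mul _))
    (fun s hs z => (hasDerivAt_hFn hs _).const_mul _)
    (fun z => by
      have := hdom r (by linarith) _ z (hCb r (GG ε z) hr).1 1 (by norm_num)
        (by have : 0 < 2 / r := by positivity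
            linarith)
      rwa [one_mul] at this)
    (fun s hs z => by
      have hs0 : 0 < s := by linarith
      refine hdom s hs _ z (hCb s (GG ε z) hs0).2.1 _ (by positivity) ?_
      have : s⁻¹ ≤ 2 / r := by
        rw [inv_le_comm₀ hs0 (by positivity), inv_div]; exact hs.le
      linarith)
  refine ⟨_, hJ ▸ key, ?_⟩
  rw [← integral_const_mul]
  have := JJ_bound_aux hφ hC ε 0 hε hr (fun T => hD1 r T) (fun T => (hCb r T hr).2.1)
  refine le_of_eq_of_le (congrArg norm (integral_congr_ae (Eventually.of_forall fun z => ?_))) this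
  have h0 : (r : ℂ) ≠ 0 := by exact_mod_cast hr.ne'
  simp only [Pi.zero_apply, zero_mul, Finset.sum_const_zero, neg_zero, zero_div]
  push_cast
  field_simp

theorem JJ_eq {φ : ℝ → ℝ} (ε v : Fin 4 → ℝ) {s : ℝ} (hs : 0 < s) :
    JJ φ ε v s = (s : ℂ) ^ 4 * ∫ z : Fin 4 → ℝ,
      ((φ (s * ‖z‖) * hFn s (s ^ 2 * GG ε z) : ℝ) : ℂ) * eC (-(∑ i, v i * z i)) := by
  have h := Measure.integral_comp_smul (volume : Measure (Fin 4 → ℝ))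
    (fun y : Fin 4 → ℝ => ((φ ‖y‖ * hFn s (GG ε y) : ℝ) : ℂ) * eC (-(∑ i, v i * y i) / s)) s
  have h2 : (∫ z : Fin 4 → ℝ,
      ((φ (s * ‖z‖) * hFn s (s ^ 2 * GG ε z) : ℝ) : ℂ) * eC (-(∑ i, v i * z i))) =
      |(s ^ Module.finrank ℝ (Fin 4 → ℝ))⁻¹| • JJ φ ε v s := by
    unfold JJ
    rw [← h]
    refine integral_congr_ae (Eventually.of_forall fun z => ?_)
    simp only [norm_smul, GG_smul, Real.norm_eq_abs, abs_of_pos hs, Pi.smul_apply, smul_eq_mul]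
    congr 2
    rw [neg_div, Finset.sum_div]
    congr 1
    refine Finset.sum_congr rfl fun i _ => ?_
    field_simp
  rw [h2, Module.finrank_fin_fun, abs_of_pos (by positivity), Complex.real_smul]
  have h0 : (s : ℂ) ≠ 0 := by exact_mod_cast hs.ne'
  push_cast
  field_simp

theorem JJ_deriv {φ : ℝ → ℝ} {L : ℝ} (hφ : Profile φ L)
    {C : ℝ} (hC : 0 ≤ C) (hCb : ∀ r T : ℝ, 0 < r →
    |hFn r T| ≤ C * (1 + r / (r ^ 2 + T ^ 2)) ∧
    |hD1 r T| ≤ C * (1 + r / (r ^ 2 + T ^ 2)) ∧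
    |hD2 r T| ≤ C * (1 + r / (r ^ 2 + T ^ 2)))
    (ε v : Fin 4 → ℝ) (hε : ∀ i, ε i = 1 ∨ ε i = -1) {r : ℝ} (hr : 0 < r) :
    ∃ D : ℂ, HasDerivAt (JJ φ ε v) D r ∧
      ‖(r : ℂ) * D‖ ≤ (5 + 2 * L) * (C * (256 + 256 * Real.pi ^ 2)) := by
  have hL : 0 ≤ L := (abs_nonneg _).trans (hφ.dbound 0)
  have hmG := (GG_continuous ε).measurable
  set R : ℝ → (Fin 4 → ℝ) → ℝ := fun s z => φ (s * ‖z‖) * hFn s (s ^ 2 * GG ε z) with hRdef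
  set R' : ℝ → (Fin 4 → ℝ) → ℝ := fun s z => deriv φ (s * ‖z‖) * ‖z‖ * hFn s (s ^ 2 * GG ε z) +
    φ (s * ‖z‖) * (s⁻¹ * hD2 s (s ^ 2 * GG ε z)) with hR'def
  set E : (Fin 4 → ℝ) → ℂ := fun z => eC (-(∑ i, v i * z i)) with hEdef
  have hnE : ∀ z, ‖E z‖ = 1 := fun z => norm_eC _
  have hRb : ∀ s, 0 < s → ∀ z, |R s z| ≤ C * Phi ε s (s • z) := by
    intro s hs z
    have h := prof_mul_le hφ ε (s • z) hs hC (hCb s (GG ε (s • z)) hs).1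
    rwa [GG_smul, norm_smul, Real.norm_eq_abs, abs_of_pos hs] at h
  have hR'b : ∀ s, 0 < s → ∀ z, |s * R' s z| ≤ (2 * L + 1) * C * Phi ε s (s • z) := by
    intro s hs z
    have h1 := dprof_mul_le hφ ε (s • z) hs hC (hCb s (GG ε (s • z)) hs).1
    have h2 := prof_mul_le hφ ε (s • z) hs hC (hCb s (GG ε (s • z)) hs).2.2
    rw [GG_smul, norm_smul, Real.norm_eq_abs, abs_of_pos hs] at h1 h2
    have h3 : s * R' s z = s * ‖z‖ * deriv φ (s * ‖z‖) * hFn s (s ^ 2 * GG ε z) +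
        φ (s * ‖z‖) * hD2 s (s ^ 2 * GG ε z) := by
      simp only [hR'def]; field_simp
    rw [h3]
    refine (abs_add_le _ _).trans ?_
    linarith
  have hball : ∀ s, r / 2 < s → ∀ z, Phi ε s (s • z) ≤
      (Metric.closedBall (0 : Fin 4 → ℝ) (4 / r)).indicator (fun _ => 1 + 2 / r) z := by
    intro s hs z
    have hs0 : 0 < s := by linarith
    refine (Phi_le ε (s • z) hr hs).trans ?_
    by_cases hz : s • z ∈ Metric.closedBall (0 : Fin 4 → ℝ) 2
    · have hz' : z ∈ Metric.closedBall (0 : Fin 4 → ℝ) (4 / r) := by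
        rw [mem_closedBall_zero_iff] at hz ⊢
        rw [norm_smul, Real.norm_eq_abs, abs_of_pos hs0] at hz
        rw [le_div_iff₀ hr]
        nlinarith [norm_nonneg z]
      rw [Set.indicator_of_mem hz, Set.indicator_of_mem hz']
    · rw [Set.indicator_of_notMem hz]
      exact Set.indicator_nonneg (fun _ _ => by positivity) _
  set K : ℝ := (1 + 2 / r) * ((2 * L + 1) * C * (1 + 2 / r)) with hK
  have hind : ∀ z, (Metric.closedBall (0 : Fin 4 → ℝ) (4 / r)).indicator (fun _ => K) z =
      (1 + 2 / r) * ((2 * L + 1) * C *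
      (Metric.closedBall (0 : Fin 4 → ℝ) (4 / r)).indicator (fun _ => 1 + 2 / r) z) := by
    intro z
    by_cases hz : z ∈ Metric.closedBall (0 : Fin 4 → ℝ) (4 / r)
    · simp only [Set.indicator_of_mem hz, hK]
    · simp only [Set.indicator_of_notMem hz, mul_zero]
  have h2r : 0 < 2 / r := by positivity
  have key : HasDerivAt (fun s => ∫ z, (R s z : ℂ) * E z) (∫ z, (R' r z : ℂ) * E z) r := by
    refine deriv_under R R' E ?_ hnE hr (4 / r) K ?_ ?_ ?_ ?_ ?_
    · exact eC_continuous.comp (by fun_prop)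
    · intro s hs
      exact ((hφ.diff.continuous.comp (continuous_const.mul continuous_norm)).measurable).mul
        ((measurable_hFn hs).comp (hmG.const_mul _))
    · refine Measurable.add ?_ ?_
      · exact (((measurable_deriv φ).comp (continuous_const.mul continuous_norm).measurable).mul
          continuous_norm.measurable).mul ((measurable_hFn hr).comp (hmG.const_mul _))
      · exact ((hφ.diff.continuous.comp (continuous_const.mul continuous_norm)).measurable).mul
          (((measurable_hD2 r).comp (hmG.const_mul _)).const_mul _)
    · intro s hs z
      have h1 : HasDerivAt (fun s : ℝ => φ (s * ‖z‖)) (deriv φ (s * ‖z‖) * ‖z‖) s :=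
        ((hφ.diff (s * ‖z‖)).hasDerivAt).comp s (hasDerivAt_mul_const _)
      exact h1.mul (hasDerivAt_hFn_scaled hs _)
    · intro z
      rw [hind]
      have h1 := hRb r hr z
      have h2 := hball r (by linarith) z
      have h3 : 0 ≤ Phi ε r (r • z) := Phi_nonneg ε hr _
      have h4 : 0 ≤ C * (Metric.closedBall (0 : Fin 4 → ℝ) (4 / r)).indicator
        (fun _ => 1 + 2 / r) z := mul_nonneg hC (h3.trans h2)
      calc |R r z| ≤ C * Phi ε r (r • z) := h1
        _ ≤ C * (Metric.closedBall (0 : Fin 4 → ℝ) (4 / r)).indicator (fun _ => 1 + 2 / r) z := by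
          gcongr
        _ ≤ ((1 + 2 / r) * (2 * L + 1)) * (C *
            (Metric.closedBall (0 : Fin 4 → ℝ) (4 / r)).indicator (fun _ => 1 + 2 / r) z) := by
          refine le_mul_of_one_le_left h4 ?_
          nlinarith [mul_nonneg hL h2r.le]
        _ = _ := by ring
    · intro s hs z
      have hs0 : 0 < s := by linarith
      rw [hind]
      have h1 := hR'b s hs0 z
      have h2 := hball s hs z
      have hsi : s⁻¹ ≤ 1 + 2 / r := by
        have : s⁻¹ ≤ 2 / r := by
          rw [inv_le_comm₀ hs0 (by positivity), inv_div]; exact hs.le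
        linarith
      have h5 : |R' s z| = s⁻¹ * |s * R' s z| := by
        rw [abs_mul, abs_of_pos hs0]; field_simp
      rw [h5]
      refine mul_le_mul hsi (h1.trans ?_) (abs_nonneg _) (by positivity)
      gcongr
  have hJ0 : ‖JJ φ ε v r‖ ≤ C * (256 + 256 * Real.pi ^ 2) :=
    JJ_bound_aux hφ hC ε v hε hr (hFn r) (fun T => (hCb r T hr).1)
  have hpow : HasDerivAt (fun s : ℝ => (s : ℂ) ^ 4) (4 * (r : ℂ) ^ 3) r := by
    have := (hasDerivAt_pow 4 (r : ℂ)).comp_ofReal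
    refine this.congr_deriv ?_
    norm_num
  have hEq : JJ φ ε v =ᶠ[nhds r] fun s => (s : ℂ) ^ 4 * ∫ z, (R s z : ℂ) * E z := by
    filter_upwards [lt_mem_nhds hr] with s hs using JJ_eq ε v hs
  refine ⟨_, (hpow.mul key).congr_of_eventuallyEq hEq, ?_⟩
  have hDM : ‖(r : ℂ) * ∫ z, (R' r z : ℂ) * E z‖ ≤
      (2 * L + 1) * C * ((r ^ 4)⁻¹ * (256 + 256 * Real.pi ^ 2)) := by
    rw [← integral_const_mul]
    have hcs := Measure.integral_comp_smul (volume : Measure (Fin 4 → ℝ)) (Phi ε r) r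
    rw [Module.finrank_fin_fun, abs_of_pos (by positivity), smul_eq_mul] at hcs
    have hPi : Integrable (fun z : Fin 4 → ℝ => Phi ε r (r • z)) :=
      (Phi_integrable ε hr).comp_smul hr.ne'
    refine (norm_integral_le_of_norm_le (hPi.const_mul ((2 * L + 1) * C))
      (Eventually.of_forall fun z => ?_)).trans ?_
    · rw [← mul_assoc, norm_mul, hnE, mul_one, ← Complex.ofReal_mul, Complex.norm_real,
        Real.norm_eq_abs]
      exact hR'b r hr z
    · rw [integral_const_mul, hcs]
      have := Phi_integral ε hε hr
      gcongr
  have hsplit : (r : ℂ) * (4 * (r : ℂ) ^ 3 * (∫ z, (R r z : ℂ) * E z) +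
      (r : ℂ) ^ 4 * ∫ z, (R' r z : ℂ) * E z) = 4 * JJ φ ε v r +
      (r : ℂ) ^ 4 * ((r : ℂ) * ∫ z, (R' r z : ℂ) * E z) := by
    rw [JJ_eq ε v hr]; ring
  rw [hsplit]
  refine (norm_add_le _ _).trans ?_
  rw [norm_mul, norm_mul ((r : ℂ) ^ 4), norm_pow, Complex.norm_real, Real.norm_eq_abs,
    abs_of_pos hr, Complex.norm_ofNat]
  have h6 : r ^ 4 * ‖(r : ℂ) * ∫ z, (R' r z : ℂ) * E z‖ ≤
      (2 * L + 1) * C * (256 + 256 * Real.pi ^ 2) := by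
    calc _ ≤ r ^ 4 * ((2 * L + 1) * C * ((r ^ 4)⁻¹ * (256 + 256 * Real.pi ^ 2))) := by gcongr
      _ = _ := by field_simp
  linarith

/-! ### The radial profile of the weights -/

theorem psi1_zero_val : Real.exp 1 * psi1 0 = 1 := by
  unfold psi1
  rw [if_pos (by norm_num), ← Real.exp_add]
  norm_num

theorem psi1_neg (t : ℝ) : psi1 (-t) = psi1 t := by
  unfold psi1
  rw [abs_neg, neg_sq]

theorem psi1_nonneg' (t : ℝ) : 0 ≤ psi1 t := by
  unfold psi1
  split_ifs
  · exact (Real.exp_pos _).le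
  · exact le_rfl

theorem exp_psi1_le (t : ℝ) : Real.exp 1 * psi1 t ≤ 1 := by
  unfold psi1
  split_ifs with h
  · rw [← Real.exp_add]
    apply Real.exp_le_one_iff.mpr
    have h1 := (sq_lt_one_iff_abs_lt_one t).mpr h
    have : 1 ≤ (1 - t ^ 2)⁻¹ := (one_le_inv₀ (by linarith)).mpr (by nlinarith [sq_nonneg t])
    linarith
  · norm_num

theorem psi1_of_le {t : ℝ} (h : t ≤ -1) : psi1 t = 0 := by
  unfold psi1
  rw [if_neg]
  rw [abs_of_nonpos (by linarith)]
  linarith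

/-- One sided cut-off. -/
noncomputable def sFn (τ : ℝ) : ℝ := Real.exp 1 * psi1 (min τ 0)

theorem sFn_of_nonneg {τ : ℝ} (h : 0 ≤ τ) : sFn τ = 1 := by
  unfold sFn; rw [min_eq_right h, psi1_zero_val]

theorem sFn_of_nonpos {τ : ℝ} (h : τ ≤ 0) : sFn τ = Real.exp 1 * psi1 τ := by
  unfold sFn; rw [min_eq_left h]

theorem sFn_nonneg (τ : ℝ) : 0 ≤ sFn τ := mul_nonneg (Real.exp_pos _).le (psi1_nonneg' _)

theorem sFn_le_one (τ : ℝ) : sFn τ ≤ 1 := exp_psi1_le _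

theorem sFn_of_le {τ : ℝ} (h : τ ≤ -1) : sFn τ = 0 := by
  rw [sFn_of_nonpos (by linarith), psi1_of_le h, mul_zero]

theorem psi1_differentiable : Differentiable ℝ psi1 :=
  psi1_contDiff.differentiable (by norm_num)

theorem psi1_hasDerivAt_zero : HasDerivAt psi1 0 0 := by
  have h := (psi1_differentiable 0).hasDerivAt
  have h2 : HasDerivAt (fun t : ℝ => psi1 (-t)) (-(deriv psi1 0)) 0 := by
    have h' : HasDerivAt psi1 (deriv psi1 0) (-0) := by rw [neg_zero]; exact h
    have := h'.comp (0 : ℝ) (hasDerivAt_neg (0 : ℝ))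
    exact this.congr_deriv (by ring)
  have h3 : (fun t : ℝ => psi1 (-t)) = psi1 := funext psi1_neg
  rw [h3] at h2
  have h4 := h.unique h2
  have h5 : deriv psi1 0 = 0 := by linarith
  rwa [h5] at h

theorem sFn_hasDerivAt (τ : ℝ) : HasDerivAt sFn (Real.exp 1 * deriv psi1 (min τ 0)) τ := by
  rcases lt_trichotomy τ 0 with h | h | h
  · rw [min_eq_left h.le]
    refine (((psi1_differentiable τ).hasDerivAt).const_mul (Real.exp 1)).congr_of_eventuallyEq ?_
    filter_upwards [gt_mem_nhds h] with s hs using sFn_of_nonpos (le_of_lt hs)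
  · subst h
    rw [min_self, psi1_hasDerivAt_zero.deriv, mul_zero]
    have h1 : HasDerivWithinAt sFn 0 (Set.Iic 0) 0 := by
      have := (psi1_hasDerivAt_zero.const_mul (Real.exp 1)).hasDerivWithinAt (s := Set.Iic 0)
      rw [mul_zero] at this
      exact this.congr (fun x hx => sFn_of_nonpos hx) (sFn_of_nonpos le_rfl)
    have h2 : HasDerivWithinAt sFn 0 (Set.Ici 0) 0 :=
      (hasDerivWithinAt_const (0 : ℝ) (Set.Ici 0) (1 : ℝ)).congr
        (fun x hx => sFn_of_nonneg hx) (sFn_of_nonneg le_rfl)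
    have h3 := h1.union h2
    rwa [Set.Iic_union_Ici, hasDerivWithinAt_univ] at h3
  · rw [min_eq_right h.le, psi1_hasDerivAt_zero.deriv, mul_zero]
    refine (hasDerivAt_const τ (1 : ℝ)).congr_of_eventuallyEq ?_
    filter_upwards [lt_mem_nhds h] with s hs using sFn_of_nonneg (le_of_lt hs)

theorem sFn_deriv_bound : ∃ D : ℝ, 0 ≤ D ∧ ∀ τ, |Real.exp 1 * deriv psi1 (min τ 0)| ≤ D := by
  have hc : Continuous fun t => Real.exp 1 * deriv psi1 t :=
    continuous_const.mul (psi1_contDiff.continuous_deriv (by norm_num))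
  obtain ⟨D, hD⟩ := (isCompact_Icc (a := (-1 : ℝ)) (b := 0)).exists_bound_of_continuousOn
    hc.continuousOn
  refine ⟨max D 0, le_max_right _ _, fun τ => ?_⟩
  by_cases h : -1 ≤ τ
  · exact (hD _ ⟨le_min h (by norm_num), min_le_right _ _⟩).trans (le_max_left _ _)
  · push Not at h
    have h1 : deriv psi1 τ = 0 := by
      have : psi1 =ᶠ[nhds τ] fun _ => 0 := by
        filter_upwards [gt_mem_nhds h] with s hs using psi1_of_le (le_of_lt hs)
      rw [this.deriv_eq]; simp
    rw [min_eq_left (by linarith), h1, mul_zero, abs_zero]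
    exact le_max_right _ _

/-- The radial profile. -/
noncomputable def prof (η b t : ℝ) : ℝ := sFn (t / η - 2) * sFn ((b - t) / η)

theorem prof_profile {D : ℝ} (hD : ∀ τ, |Real.exp 1 * deriv psi1 (min τ 0)| ≤ D) {η b : ℝ}
    (hη : 0 < η) (hη4 : η < 1 / 4) (hb1 : b ≤ 1) : Profile (prof η b) (2 * D / η) := by
  have hd : ∀ t, HasDerivAt (prof η b)
      (Real.exp 1 * deriv psi1 (min (t / η - 2) 0) * (1 / η) * sFn ((b - t) / η) +
        sFn (t / η - 2) * (Real.exp 1 * deriv psi1 (min ((b - t) / η) 0) * (-1 / η))) t := by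
    intro t
    have h1 : HasDerivAt (fun t : ℝ => t / η - 2) (1 / η) t :=
      ((hasDerivAt_id t).div_const η).sub_const 2
    have h2 : HasDerivAt (fun t : ℝ => (b - t) / η) (-1 / η) t :=
      ((hasDerivAt_id t).const_sub b).div_const η
    exact ((sFn_hasDerivAt _).comp t h1).mul ((sFn_hasDerivAt _).comp t h2)
  refine ⟨fun t => (hd t).differentiableAt, fun t => mul_nonneg (sFn_nonneg _) (sFn_nonneg _),
    fun t => mul_le_one₀ (sFn_le_one _) (sFn_nonneg _) (sFn_le_one _), fun t ht => ?_, fun t => ?_⟩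
  · unfold prof
    rw [sFn_of_le (τ := (b - t) / η), mul_zero]
    rw [div_le_iff₀ hη]; linarith
  · rw [(hd t).deriv]
    refine (abs_add_le _ _).trans ?_
    rw [abs_mul _ (sFn ((b - t) / η)), abs_mul _ (1 / η), abs_mul (sFn (t / η - 2)),
      abs_mul _ (-1 / η), abs_of_nonneg (sFn_nonneg _),
      abs_of_nonneg (sFn_nonneg _), neg_div, abs_neg, abs_of_pos (show 0 < 1 / η by positivity)]
    have hD0 : 0 ≤ D := (abs_nonneg _).trans (hD 0)
    have e1 := hD (t / η - 2)
    have e2 := hD ((b - t) / η)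
    have a1 := sFn_nonneg ((b - t) / η)
    have a2 := sFn_nonneg (t / η - 2)
    calc _ ≤ D * (1 / η) * 1 + 1 * (D * (1 / η)) := by
          gcongr
          · exact sFn_le_one _
          · exact sFn_le_one _
      _ = _ := by ring

theorem prof_eq {η b t : ℝ} (hη : 0 < η) (hb : 2 * η ≤ b) :
    prof η b t = if t ≤ η then 0
      else if t ≤ 2 * η then Real.exp 1 * psi1 (t / η - 2)
      else if t ≤ b then 1
      else if t ≤ b + η then Real.exp 1 * psi1 (t / η - b / η)
      else 0 := by
  unfold prof
  split_ifs with h1 h2 h3 h4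
  · rw [sFn_of_le, zero_mul]
    have : t / η ≤ 1 := (div_le_one hη).mpr h1
    linarith
  · rw [sFn_of_nonpos, sFn_of_nonneg, mul_one]
    · apply div_nonneg _ hη.le; linarith
    · have : t / η ≤ 2 := (div_le_iff₀ hη).mpr h2
      linarith
  · rw [sFn_of_nonneg, sFn_of_nonneg, mul_one]
    · apply div_nonneg _ hη.le; linarith
    · have : 2 ≤ t / η := (le_div_iff₀ hη).mpr (by linarith)
      linarith
  · rw [sFn_of_nonneg, sFn_of_nonpos, one_mul, ← psi1_neg]
    · congr 2; ring
    · rw [div_le_iff₀ hη]; linarith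
    · have : 2 ≤ t / η := (le_div_iff₀ hη).mpr (by linarith)
      linarith
  · rw [sFn_of_le (τ := (b - t) / η), mul_zero]
    rw [div_le_iff₀ hη]; linarith

theorem w1_eq {η : ℝ} (hη : 0 < η) (hη4 : η < 1 / 4) (x : Fin 4 → ℝ) :
    w1 η x = prof η (1 - η) ‖x‖ := by
  rw [prof_eq hη (by linarith), sub_add_cancel]; rfl

theorem w2_eq {η : ℝ} (hη : 0 < η) (hη4 : η < 1 / 4) (x : Fin 4 → ℝ) :
    w2 η x = prof η 1 ‖x‖ := by
  rw [prof_eq hη (by linarith)]; rfl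

/-! ### Scaling -/

theorem integral_diag (P : Fin 4 → ℝ) (hP : ∀ i, 0 < P i) (f : (Fin 4 → ℝ) → ℂ) :
    ∫ x, f x = ((∏ i, P i : ℝ) : ℂ) * ∫ y : Fin 4 → ℝ, f (fun i => P i * y i) := by
  have hprod : 0 < ∏ i, P i := Finset.prod_pos fun i _ => hP i
  have hdet : Matrix.det (Matrix.diagonal P) = ∏ i, P i := Matrix.det_diagonal
  have h := Real.smul_map_diagonal_volume_pi (D := P) (by rw [hdet]; exact hprod.ne')
  rw [hdet, abs_of_pos hprod] at h
  let T : (Fin 4 → ℝ) ≃ₜ (Fin 4 → ℝ) :=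
    Homeomorph.piCongrRight fun i => Homeomorph.mulLeft₀ (P i) (hP i).ne'
  have hT : ∀ y : Fin 4 → ℝ, T y = fun i => P i * y i := fun y => rfl
  have hT2 : (⇑(Matrix.toLin' (Matrix.diagonal P)) : (Fin 4 → ℝ) → (Fin 4 → ℝ)) = T := by
    funext y
    rw [hT, Matrix.toLin'_apply]
    funext i
    rw [Matrix.mulVec_diagonal]
  rw [hT2] at h
  conv_lhs => rw [← h]
  rw [integral_smul_measure, T.measurableEmbedding.integral_map, ENNReal.toReal_ofReal hprod.le,
    Complex.real_smul]
  rfl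

theorem Pvec_pos {a : Fin 4 → ℤ} {B : ℝ} (ha : ∀ i, a i ≠ 0) (hB : 1 ≤ B) (i : Fin 4) :
    0 < Pvec a B i := by
  unfold Pvec
  have : 0 < (a i).natAbs := Int.natAbs_pos.mpr (ha i)
  have : (0 : ℝ) < (a i).natAbs := by exact_mod_cast this
  apply Real.sqrt_pos.mpr
  positivity

theorem Iqa_eq {φ : ℝ → ℝ} {w : (Fin 4 → ℝ) → ℝ} (hw : ∀ x, w x = φ ‖x‖) {a c : Fin 4 → ℤ} {B q : ℝ}
    (ha : ∀ i, a i ≠ 0) (hB : 1 ≤ B) :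
    Iqa w a B c q = ((∏ i, Pvec a B i : ℝ) : ℂ) *
      JJ φ (fun i => ((a i).sign : ℝ)) (fun i => c i * Pvec a B i / Real.sqrt B)
        (q / Real.sqrt B) := by
  have hsB : 0 < Real.sqrt B := Real.sqrt_pos.mpr (by linarith)
  unfold Iqa JJ
  rw [integral_diag (Pvec a B) (Pvec_pos ha hB)]
  refine congrArg (HMul.hMul _) (integral_congr_ae (Eventually.of_forall fun y => ?_))
  have h1 : (fun i => Pvec a B i * y i / Pvec a B i) = y := by
    funext i
    have := (Pvec_pos ha hB i).ne'
    field_simp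
  have h2 : (∑ i, (a i : ℝ) * (Pvec a B i * y i) ^ 2) / B =
      GG (fun i => ((a i).sign : ℝ)) y := by
    unfold GG
    rw [Finset.sum_div]
    refine Finset.sum_congr rfl fun i _ => ?_
    have hna : 0 < (a i).natAbs := Int.natAbs_pos.mpr (ha i)
    have hna' : (0 : ℝ) < (a i).natAbs := by exact_mod_cast hna
    have hsq : Pvec a B i ^ 2 = B / ((a i).natAbs : ℝ) := by
      unfold Pvec
      exact Real.sq_sqrt (by positivity)
    have hs : (a i : ℝ) = ((a i).sign : ℝ) * ((a i).natAbs : ℝ) := by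
      have h := congrArg (Int.cast : ℤ → ℝ) (Int.sign_mul_natAbs (a i))
      rw [Int.cast_mul, Int.cast_natCast] at h
      exact h.symm
    have hB0 : B ≠ 0 := by positivity
    rw [mul_pow, hsq]
    conv_lhs => rw [hs]
    field_simp
  have h3 : -(∑ i, (c i : ℝ) * (Pvec a B i * y i)) / q =
      -(∑ i, c i * Pvec a B i / Real.sqrt B * y i) / (q / Real.sqrt B) := by
    have : (∑ i, c i * Pvec a B i / Real.sqrt B * y i) =
        (∑ i, (c i : ℝ) * (Pvec a B i * y i)) / Real.sqrt B := by
      rw [Finset.sum_div]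
      exact Finset.sum_congr rfl fun i _ => by ring
    rw [this, ← neg_div, div_div_div_cancel_right₀ hsB.ne']
  simp only [h1, h2, h3, hw]
  push_cast
  rfl

theorem main_aux {C D : ℝ} (hC : 0 ≤ C) (hCb : ∀ r T : ℝ, 0 < r →
    |hFn r T| ≤ C * (1 + r / (r ^ 2 + T ^ 2)) ∧
    |hD1 r T| ≤ C * (1 + r / (r ^ 2 + T ^ 2)) ∧
    |hD2 r T| ≤ C * (1 + r / (r ^ 2 + T ^ 2))) (hD0 : 0 ≤ D)
    {η : ℝ} (hη : 0 < η) (hη4 : η < 1 / 4) {φ : ℝ → ℝ} (hφ : Profile φ (2 * D / η))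
    {w : (Fin 4 → ℝ) → ℝ} (hw : ∀ x, w x = φ ‖x‖) {a c : Fin 4 → ℤ} {B q : ℝ}
    (ha : ∀ i, a i ≠ 0) (hB : 1 ≤ B) (hq : 0 < q) :
    DifferentiableAt ℝ (Iqa w a B c) q ∧
    ‖Iqa w a B c q‖ ≤ (C * (256 + 256 * Real.pi ^ 2)) * ∏ i, Pvec a B i ∧
    (c = 0 → ‖(q : ℂ) * deriv (Iqa w a B c) q‖ ≤
      (C * (256 + 256 * Real.pi ^ 2)) * ∏ i, Pvec a B i) ∧
    ‖(q : ℂ) * deriv (Iqa w a B c) q‖ ≤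
      ((5 + 4 * D) * (C * (256 + 256 * Real.pi ^ 2))) * η⁻¹ * ∏ i, Pvec a B i := by
  have hsB : 0 < Real.sqrt B := Real.sqrt_pos.mpr (by linarith)
  have hprod : 0 < ∏ i, Pvec a B i := Finset.prod_pos fun i _ => Pvec_pos ha hB i
  set ε : Fin 4 → ℝ := fun i => ((a i).sign : ℝ) with hεd
  set v : Fin 4 → ℝ := fun i => c i * Pvec a B i / Real.sqrt B with hv
  have hε : ∀ i, ε i = 1 ∨ ε i = -1 := by
    intro i
    rcases lt_or_gt_of_ne (ha i) with h | h
    · right; simp only [hεd, Int.sign_eq_neg_one_of_neg h]; norm_num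
    · left; simp only [hεd, Int.sign_eq_one_of_pos h]; norm_num
  have hr : 0 < q / Real.sqrt B := by positivity
  have hI : Iqa w a B c = fun q => ((∏ i, Pvec a B i : ℝ) : ℂ) * JJ φ ε v (q / Real.sqrt B) :=
    funext fun q => Iqa_eq hw ha hB
  have trans : ∀ E K, HasDerivAt (JJ φ ε v) E (q / Real.sqrt B) →
      ‖((q / Real.sqrt B : ℝ) : ℂ) * E‖ ≤ K →
      DifferentiableAt ℝ (Iqa w a B c) q ∧
      ‖(q : ℂ) * deriv (Iqa w a B c) q‖ ≤ K * ∏ i, Pvec a B i := by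
    intro E K hE hK
    have h1 : HasDerivAt (fun q : ℝ => q / Real.sqrt B) (1 / Real.sqrt B) q :=
      (hasDerivAt_id q).div_const _
    have h2 : HasDerivAt (Iqa w a B c)
        (((∏ i, Pvec a B i : ℝ) : ℂ) * ((1 / Real.sqrt B : ℝ) • E)) q := by
      rw [hI]
      exact (HasDerivAt.scomp q hE h1).const_mul _
    refine ⟨h2.differentiableAt, ?_⟩
    rw [h2.deriv]
    have h3 : (q : ℂ) * (((∏ i, Pvec a B i : ℝ) : ℂ) * ((1 / Real.sqrt B : ℝ) • E)) =
        ((∏ i, Pvec a B i : ℝ) : ℂ) * (((q / Real.sqrt B : ℝ) : ℂ) * E) := by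
      rw [Complex.real_smul, Complex.ofReal_div, Complex.ofReal_div, Complex.ofReal_one]
      ring
    rw [h3, norm_mul, Complex.norm_real, Real.norm_eq_abs, abs_of_pos hprod, mul_comm]
    gcongr
  obtain ⟨E, hE, hEb⟩ := JJ_deriv hφ hC hCb ε v hε hr
  obtain ⟨hdiff, hb⟩ := trans E _ hE hEb
  refine ⟨hdiff, ?_, ?_, ?_⟩
  · rw [hI]
    simp only
    rw [norm_mul, Complex.norm_real, Real.norm_eq_abs, abs_of_pos hprod, mul_comm]
    have := JJ_bound_aux hφ hC ε v hε hr (hFn (q / Real.sqrt B)) (fun T => (hCb _ T hr).1)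
    exact mul_le_mul_of_nonneg_right this hprod.le
  · intro hc
    have hv0 : v = 0 := by
      funext i; simp [hv, hc]
    obtain ⟨E0, hE0, hEb0⟩ := JJ_deriv_zero hφ hC hCb ε hε hr
    rw [← hv0] at hE0
    exact (trans E0 _ hE0 hEb0).2
  · refine hb.trans (mul_le_mul_of_nonneg_right ?_ hprod.le)
    have hη1 : 1 ≤ η⁻¹ := (one_le_inv₀ hη).mpr (by linarith)
    have hA : 0 ≤ C * (256 + 256 * Real.pi ^ 2) := by positivity
    have : 5 + 2 * (2 * D / η) ≤ (5 + 4 * D) * η⁻¹ := by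
      have : 2 * (2 * D / η) = 4 * D * η⁻¹ := by ring
      rw [this]; linarith
    calc _ ≤ ((5 + 4 * D) * η⁻¹) * (C * (256 + 256 * Real.pi ^ 2)) := by gcongr
      _ = _ := by ring

/-- Lemma 4.5: bounds for `I_{q,a}(c)` and its derivative in `q`. -/
theorem statement_7 :
    ∃ C : ℝ, 0 < C ∧
      ∀ (η : ℝ) (a : Fin 4 → ℤ) (B : ℝ) (w : (Fin 4 → ℝ) → ℝ) (c : Fin 4 → ℤ),
        η ∈ Set.Ioo (0 : ℝ) (1 / 4) → (∀ i, a i ≠ 0) → 1 ≤ B →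
        (w = w1 η ∨ w = w2 η) →
        (∀ q : ℝ, 0 < q → DifferentiableAt ℝ (Iqa w a B c) q) ∧
        (∀ q : ℝ, 0 < q → ‖Iqa w a B c q‖ ≤ C * ∏ i, Pvec a B i) ∧
        (c = 0 → ∀ q : ℝ, 0 < q →
          ‖(q : ℂ) * deriv (Iqa w a B c) q‖ ≤ C * ∏ i, Pvec a B i) ∧
        (c ≠ 0 → ∀ q : ℝ, 0 < q →
          ‖(q : ℂ) * deriv (Iqa w a B c) q‖ ≤ C * η⁻¹ * ∏ i, Pvec a B i) := by
  obtain ⟨C, hC, hCb⟩ := h_bounds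
  obtain ⟨D, hD0, hD⟩ := sFn_deriv_bound
  have hA : 0 ≤ C * (256 + 256 * Real.pi ^ 2) := by positivity
  set A : ℝ := C * (256 + 256 * Real.pi ^ 2) with hAdef
  have hle : A ≤ (5 + 4 * D) * A + 1 := by nlinarith [mul_nonneg hD0 hA]
  refine ⟨(5 + 4 * D) * A + 1, by positivity, ?_⟩
  intro η a B w c hη ha hB hw
  obtain ⟨hη0, hη4⟩ := hη
  have hprod : 0 < ∏ i, Pvec a B i := Finset.prod_pos fun i _ => Pvec_pos ha hB i
  obtain ⟨φ, hφ, hwφ⟩ : ∃ φ, Profile φ (2 * D / η) ∧ ∀ x, w x = φ ‖x‖ := by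
    rcases hw with rfl | rfl
    · exact ⟨_, prof_profile hD hη0 hη4 (by linarith), w1_eq hη0 hη4⟩
    · exact ⟨_, prof_profile hD hη0 hη4 le_rfl, w2_eq hη0 hη4⟩
  have key := fun (q : ℝ) (hq : 0 < q) =>
    main_aux (c := c) hC hCb hD0 hη0 hη4 hφ hwφ ha hB hq
  refine ⟨fun q hq => (key q hq).1, fun q hq => (key q hq).2.1.trans ?_,
    fun hc q hq => ((key q hq).2.2.1 hc).trans ?_, fun _ q hq => (key q hq).2.2.2.trans ?_⟩
  · exact mul_le_mul_of_nonneg_right hle hprod.le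
  · exact mul_le_mul_of_nonneg_right hle hprod.le
  · refine mul_le_mul_of_nonneg_right ?_ hprod.le
    exact mul_le_mul_of_nonneg_right (by linarith) (inv_nonneg.mpr hη0.le)
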